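/- Let n ≥ 1, s ∈ (0,1), 1 ≤ p < ∞ with sp = n, let Ω ⊂ ℝⁿ be a bounded open set, and let 1 ≤ q < ∞. Then for every sequence (u_k) of functions in C_c^∞(ℝⁿ) such that sup_k ( ‖u_k‖_{L^p(ℝⁿ)} + ‖D^s u_k‖_{L^p(ℝⁿ;ℝⁿ)} ) < ∞, there exists a subsequence (u_{k_j}) whose restrictions to Ω converge in L^q(Ω). (Compactness of the embedding H^{s,p}(ℝⁿ) ↪ L^q(Ω) in the critical case, where H^{s,p}(ℝⁿ) is the closure of C_c^∞(ℝⁿ) in the norm ‖u‖_{L^p} + ‖D^s u‖_{L^p}.) -/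

import Mathlib

open MeasureTheory Filter

noncomputable section

/-- The normalization constant `c_{n,s}` of the Riesz fractional gradient. -/
def cns (n : ℕ) (s : ℝ) : ℝ :=
  ((n : ℝ) + s - 1) * Real.Gamma (((n : ℝ) + s - 1) / 2) /
    (Real.pi ^ ((n : ℝ) / 2) * (2 : ℝ) ^ (1 - s) * Real.Gamma ((1 - s) / 2))

/-- The Riesz fractional gradient
`D^s u (x) = c_{n,s} ∫ (u(x) - u(y))/|x-y|^{n+s} ⬝ (x-y)/|x-y| dy`. -/
def rieszGrad (n : ℕ) (s : ℝ) (u : EuclideanSpace ℝ (Fin n) → ℝ)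
    (x : EuclideanSpace ℝ (Fin n)) : EuclideanSpace ℝ (Fin n) :=
  cns n s • ∫ y, ((u x - u y) / ‖x - y‖ ^ ((n : ℝ) + s + 1)) • (x - y)

section Part0
open MeasureTheory Filter Set
open scoped RealInnerProductSpace

section A
variable {E : Type*} [NormedAddCommGroup E] [InnerProductSpace ℝ E] [FiniteDimensional ℝ E]
  [MeasurableSpace E] [BorelSpace E]

lemma integrable_min_rpow [Nontrivial E] (α β a : ℝ)
    (h1 : a - α < Module.finrank ℝ E) (h2 : Module.finrank ℝ E < a - β) :
    Integrable (fun z : E => min (‖z‖ ^ α) (‖z‖ ^ β) / ‖z‖ ^ a) := by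
  have hd : 1 ≤ Module.finrank ℝ E := Module.finrank_pos
  rw [integrable_fun_norm_addHaar (volume : Measure E)
    (f := fun r : ℝ => min (r ^ α) (r ^ β) / r ^ a)]
  set d := Module.finrank ℝ E
  have hpow : ∀ r : ℝ, 0 < r → r ^ (d - 1) = r ^ ((d : ℝ) - 1) := by
    intro r hr
    rw [← Real.rpow_natCast]
    push_cast [Nat.cast_sub hd]
    rfl
  have hmeas : Measurable (fun y : ℝ => y ^ (d - 1) • (min (y ^ α) (y ^ β) / y ^ a)) := by
    fun_prop
  rw [← Ioc_union_Ioi_eq_Ioi zero_le_one]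
  refine IntegrableOn.union ?_ ?_
  · have := (intervalIntegral.intervalIntegrable_rpow' (a := 0) (b := 1)
      (r := (d : ℝ) - 1 + α - a) (by linarith)).1
    refine Integrable.mono' this hmeas.aestronglyMeasurable ?_
    filter_upwards [ae_restrict_mem measurableSet_Ioc] with r hr
    have hr0 : 0 < r := hr.1
    rw [hpow r hr0, Real.norm_of_nonneg (by positivity), Real.rpow_sub hr0 (_ + _), Real.rpow_add hr0,
      smul_eq_mul, ← mul_div_assoc]
    gcongr
    exact min_le_left _ _
  · have := integrableOn_Ioi_rpow_of_lt (a := (d : ℝ) - 1 + β - a) (c := 1) (by linarith) one_pos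
    refine Integrable.mono' this hmeas.aestronglyMeasurable ?_
    filter_upwards [ae_restrict_mem measurableSet_Ioi] with r hr
    have hr0 : 0 < r := one_pos.trans hr
    rw [hpow r hr0, Real.norm_of_nonneg (by positivity), Real.rpow_sub hr0 (_ + _), Real.rpow_add hr0,
      smul_eq_mul, ← mul_div_assoc]
    gcongr
    exact min_le_right _ _

lemma integrable_of_le_min_rpow [Nontrivial E] (α β a C : ℝ) (g : E → ℝ) (hg : Measurable g)
    (h1 : a - α < Module.finrank ℝ E) (h2 : Module.finrank ℝ E < a - β)
    (hb : ∀ z, |g z| ≤ C * min (‖z‖ ^ α) (‖z‖ ^ β)) :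
    Integrable (fun z : E => g z / ‖z‖ ^ a) := by
  refine Integrable.mono' ((integrable_min_rpow α β a h1 h2).const_mul C)
    (by fun_prop : Measurable _).aestronglyMeasurable ?_
  refine Eventually.of_forall fun z => ?_
  rw [norm_div, Real.norm_eq_abs, Real.norm_of_nonneg (by positivity), ← mul_div_assoc]
  gcongr
  exact hb z

/-- the auxiliary cosine integral -/
noncomputable def cosInt (a : ℝ) (ξ : E) : ℝ := ∫ z : E, (1 - Real.cos ⟪z, ξ⟫) / ‖z‖ ^ a

lemma cosInt_integrable [Nontrivial E] (s : ℝ) (hs0 : 0 < s) (hs1 : s < 1) (ξ : E) :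
    Integrable (fun z : E => (1 - Real.cos ⟪z, ξ⟫) / ‖z‖ ^ ((Module.finrank ℝ E : ℝ) + s + 1)) := by
  refine integrable_of_le_min_rpow 2 0 _ (max (‖ξ‖ ^ 2) 2) _ ?_ (by linarith) (by linarith) ?_
  · exact (by fun_prop : Continuous _).measurable
  intro z
  have h1 : Real.cos ⟪z, ξ⟫ ≤ 1 := Real.cos_le_one _
  have h2 : -1 ≤ Real.cos ⟪z, ξ⟫ := Real.neg_one_le_cos _
  have h3 : 1 - ⟪z, ξ⟫ ^ 2 / 2 ≤ Real.cos ⟪z, ξ⟫ := Real.one_sub_sq_div_two_le_cos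
  have h4 : ⟪z, ξ⟫ ^ 2 ≤ (‖z‖ * ‖ξ‖) ^ 2 := by
    rw [← sq_abs]
    gcongr
    exact abs_real_inner_le_norm z ξ
  rw [abs_of_nonneg (by linarith)]
  simp only [Real.rpow_zero, Real.rpow_two]
  rcases le_total (‖z‖ ^ 2) 1 with h | h
  · rw [min_eq_left h]
    calc _ ≤ ‖ξ‖ ^ 2 * ‖z‖ ^ 2 := by nlinarith
      _ ≤ _ := by gcongr; exact le_max_left _ _
  · rw [min_eq_right h]
    linarith [le_max_right (‖ξ‖ ^ 2) 2]

lemma cosInt_pos [Nontrivial E] (s : ℝ) (hs0 : 0 < s) (hs1 : s < 1) (ξ : E) (hξ : ξ ≠ 0) :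
    0 < cosInt ((Module.finrank ℝ E : ℝ) + s + 1) ξ := by
  have hnn : ∀ z : E, 0 ≤ (1 - Real.cos ⟪z, ξ⟫) / ‖z‖ ^ ((Module.finrank ℝ E : ℝ) + s + 1) :=
    fun z => div_nonneg (by linarith [Real.cos_le_one ⟪z, ξ⟫]) (by positivity)
  unfold cosInt
  rw [integral_pos_iff_support_of_nonneg hnn (cosInt_integrable s hs0 hs1 ξ)]
  have hopen : IsOpen {z : E | Real.cos ⟪z, ξ⟫ < 1} :=
    isOpen_lt (by fun_prop) continuous_const
  refine lt_of_lt_of_le (hopen.measure_pos volume ⟨(Real.pi / ‖ξ‖ ^ 2) • ξ, ?_⟩)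
    (measure_mono (s := {z : E | Real.cos ⟪z, ξ⟫ < 1}) ?_)
  · have : ‖ξ‖ ≠ 0 := by simpa using hξ
    have h : ⟪(Real.pi / ‖ξ‖ ^ 2) • ξ, ξ⟫ = Real.pi := by
      rw [real_inner_smul_left, real_inner_self_eq_norm_sq]; field_simp
    simp only [mem_ofPred_eq, h, Real.cos_pi]; norm_num
  · intro z hz
    have hz : Real.cos ⟪z, ξ⟫ < 1 := hz
    have hz0 : z ≠ 0 := by rintro rfl; simp at hz
    have : 0 < ‖z‖ := norm_pos_iff.2 hz0
    exact (div_pos (by linarith) (by positivity)).ne'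

lemma cosInt_smul (s : ℝ) (t : ℝ) (ht : 0 < t) (ξ : E) :
    cosInt ((Module.finrank ℝ E : ℝ) + s + 1) (t • ξ) =
      t ^ (1 + s) * cosInt ((Module.finrank ℝ E : ℝ) + s + 1) ξ := by
  unfold cosInt
  have h := Measure.integral_comp_smul (volume : Measure E) (fun z : E =>
    (1 - Real.cos ⟪z, ξ⟫) / ‖z‖ ^ ((Module.finrank ℝ E : ℝ) + s + 1)) t
  set d := Module.finrank ℝ E
  have h' : ∀ z : E, (1 - Real.cos ⟪z, t • ξ⟫) / ‖z‖ ^ ((d : ℝ) + s + 1) =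
      t ^ ((d : ℝ) + s + 1) * ((1 - Real.cos ⟪t • z, ξ⟫) / ‖t • z‖ ^ ((d : ℝ) + s + 1)) := by
    intro z
    rw [real_inner_smul_right, real_inner_smul_left, norm_smul, Real.norm_of_nonneg ht.le,
      Real.mul_rpow ht.le (norm_nonneg _)]
    have : t ^ ((d : ℝ) + s + 1) ≠ 0 := by positivity
    field_simp
  simp_rw [h']
  rw [integral_const_mul, h, smul_eq_mul, ← mul_assoc]
  congr 1
  rw [abs_of_nonneg (by positivity), ← Real.rpow_natCast, ← Real.rpow_neg ht.le,
    ← Real.rpow_add ht]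
  congr 1
  ring

lemma cosInt_eq_of_norm_eq (a : ℝ) (ξ η : E) (h : ‖ξ‖ = ‖η‖) : cosInt a ξ = cosInt a η := by
  let R : E ≃ₗᵢ[ℝ] E := (ℝ ∙ (ξ - η))ᗮ.reflection
  have hR : R ξ = η := Submodule.reflection_sub h
  unfold cosInt
  have := R.measurePreserving.integral_comp R.toHomeomorph.measurableEmbedding
    (fun z : E => (1 - Real.cos ⟪z, η⟫) / ‖z‖ ^ a)
  rw [← this]
  congr 1
  ext z
  rw [← hR, LinearIsometryEquiv.inner_map_map, LinearIsometryEquiv.norm_map]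

/-- the auxiliary sine integral -/
noncomputable def sinInt (a : ℝ) (ξ : E) : ℝ := ∫ z : E, (Real.sin ⟪z, ξ⟫ * ⟪z, ξ⟫) / ‖z‖ ^ a

lemma sin_bound (ξ z : E) (t : ℝ) (ht : |t| ≤ 2) : |Real.sin ⟪z, t • ξ⟫ * ⟪z, ξ⟫| ≤
    (2 * ‖ξ‖ ^ 2 + ‖ξ‖) * min (‖z‖ ^ (2 : ℝ)) (‖z‖ ^ (1 : ℝ)) := by
  have h4 : |⟪z, ξ⟫| ≤ ‖z‖ * ‖ξ‖ := abs_real_inner_le_norm z ξ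
  have h1 : |Real.sin ⟪z, t • ξ⟫| ≤ 1 := Real.abs_sin_le_one _
  have h2 : |Real.sin ⟪z, t • ξ⟫| ≤ 2 * |⟪z, ξ⟫| := by
    refine Real.abs_sin_le_abs.trans ?_
    rw [real_inner_smul_right, abs_mul]
    gcongr
  simp only [Real.rpow_two, Real.rpow_one]
  rw [abs_mul, mul_min_of_nonneg _ _ (by positivity)]
  refine le_min ?_ ?_
  · calc _ ≤ (2 * (‖z‖ * ‖ξ‖)) * (‖z‖ * ‖ξ‖) := by gcongr; exact h2.trans (by gcongr)
      _ ≤ _ := by nlinarith [mul_nonneg (norm_nonneg ξ) (sq_nonneg ‖z‖)]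
  · calc _ ≤ 1 * (‖z‖ * ‖ξ‖) := by gcongr
      _ ≤ _ := by nlinarith [mul_nonneg (sq_nonneg ‖ξ‖) (norm_nonneg z)]

lemma sinInt_eq [Nontrivial E] (s : ℝ) (hs0 : 0 < s) (hs1 : s < 1) (ξ : E) :
    sinInt ((Module.finrank ℝ E : ℝ) + s + 1) ξ =
      (1 + s) * cosInt ((Module.finrank ℝ E : ℝ) + s + 1) ξ := by
  set a := (Module.finrank ℝ E : ℝ) + s + 1 with ha
  have hd : HasDerivAt (fun t : ℝ => cosInt a (t • ξ)) (sinInt a ξ) 1 := by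
    have := (hasDerivAt_integral_of_dominated_loc_of_deriv_le (μ := (volume : Measure E))
      (F := fun (t : ℝ) (z : E) => (1 - Real.cos ⟪z, t • ξ⟫) / ‖z‖ ^ a)
      (F' := fun (t : ℝ) (z : E) => (Real.sin ⟪z, t • ξ⟫ * ⟪z, ξ⟫) / ‖z‖ ^ a) (x₀ := 1)
      (s := Metric.ball (1 : ℝ) 1)
      (bound := fun z => ((2 * ‖ξ‖ ^ 2 + ‖ξ‖) * min (‖z‖ ^ (2 : ℝ)) (‖z‖ ^ (1 : ℝ))) / ‖z‖ ^ a)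
      (Metric.ball_mem_nhds _ one_pos) ?_ ?_ ?_ ?_ ?_ ?_).2
    · simpa [sinInt, cosInt] using this
    · exact Eventually.of_forall fun t => (cosInt_integrable s hs0 hs1 (t • ξ)).1
    · exact cosInt_integrable s hs0 hs1 _
    · have : Measurable fun z : E => Real.sin ⟪z, (1 : ℝ) • ξ⟫ * ⟪z, ξ⟫ :=
        (by fun_prop : Continuous _).measurable
      exact (by fun_prop : Measurable _).aestronglyMeasurable
    · refine Eventually.of_forall fun z t ht => ?_
      rw [norm_div, Real.norm_eq_abs, Real.norm_of_nonneg (by positivity)]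
      gcongr
      apply sin_bound
      rw [Metric.mem_ball, Real.dist_eq] at ht
      have := abs_lt.1 ht
      exact abs_le.2 ⟨by linarith, by linarith⟩
    · simp_rw [mul_div_assoc]
      exact (integrable_min_rpow 2 1 a (by linarith) (by linarith)).const_mul _
    · refine Eventually.of_forall fun z t ht => ?_
      simp_rw [real_inner_smul_right]
      have := ((((hasDerivAt_id t).mul_const ⟪z, ξ⟫).cos.const_sub 1).div_const (‖z‖ ^ a))
      simpa using this
  have hd2 : HasDerivAt (fun t : ℝ => t ^ (1 + s) * cosInt a ξ) ((1 + s) * cosInt a ξ) 1 := by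
    have := (Real.hasDerivAt_rpow_const (x := 1) (p := 1 + s) (Or.inl one_ne_zero)).mul_const
      (cosInt a ξ)
    simpa using this
  refine hd.unique (hd2.congr_of_eventuallyEq ?_)
  filter_upwards [lt_mem_nhds (zero_lt_one (α := ℝ))] with t ht
  exact cosInt_smul s t ht ξ

/-- the value of the symbol of the Riesz fractional gradient, up to the constant -/
lemma exists_symbol [Nontrivial E] (s : ℝ) (hs0 : 0 < s) (hs1 : s < 1) :
    ∃ κ : ℝ, 0 < κ ∧ ∀ ξ : E, ∫ z : E, (Real.sin (2 * Real.pi * ⟪z, ξ⟫) * ⟪z, ξ⟫) /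
      ‖z‖ ^ ((Module.finrank ℝ E : ℝ) + s + 1) = κ * ‖ξ‖ ^ (1 + s) := by
  obtain ⟨e, he⟩ : ∃ e : E, ‖e‖ = 1 := exists_norm_eq E zero_le_one
  have he0 : e ≠ 0 := by rintro rfl; simp at he
  have hpi := Real.pi_pos
  set a := (Module.finrank ℝ E : ℝ) + s + 1 with ha
  refine ⟨(2 * Real.pi) ^ (1 + s) * (1 + s) * cosInt a e / (2 * Real.pi), ?_, fun ξ => ?_⟩
  · have := cosInt_pos s hs0 hs1 e he0
    positivity
  have h1 : ∫ z : E, (Real.sin (2 * Real.pi * ⟪z, ξ⟫) * ⟪z, ξ⟫) / ‖z‖ ^ a =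
      sinInt a ((2 * Real.pi) • ξ) / (2 * Real.pi) := by
    unfold sinInt
    rw [← integral_div]
    congr 1
    ext z
    rw [real_inner_smul_right]
    field_simp
  rw [h1, sinInt_eq s hs0 hs1, cosInt_smul s _ (by positivity)]
  rcases eq_or_ne ξ 0 with rfl | hξ
  · have : (0 : ℝ) ^ (1 + s) = 0 := Real.zero_rpow (by linarith)
    simp [cosInt, this]
  · have h2 : cosInt a ξ = ‖ξ‖ ^ (1 + s) * cosInt a e := by
      rw [← cosInt_smul s _ (norm_pos_iff.2 hξ)]
      exact cosInt_eq_of_norm_eq _ _ _ (by simp [norm_smul, he])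
    rw [h2]
    ring
end A
end Part0

section Part1
open MeasureTheory Filter Set
open scoped RealInnerProductSpace FourierTransform

section B
variable {E : Type*} [NormedAddCommGroup E] [InnerProductSpace ℝ E] [FiniteDimensional ℝ E]
  [MeasurableSpace E] [BorelSpace E]

/-- the integrand of the fractional gradient after a change of variables -/
noncomputable def gradKer (a : ℝ) (u : E → ℝ) (w : E × E) : E :=
  ((u w.1 - u (w.1 - w.2)) / ‖w.2‖ ^ a) • w.2

lemma diff_bound (u : E → ℝ) (hu : ContDiff ℝ 1 u) (hc : HasCompactSupport u) :
    ∃ C : ℝ, 0 ≤ C ∧ ∀ x z, |u x - u (x - z)| ≤ C * min ‖z‖ 1 *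
      ((tsupport u).indicator 1 x + (tsupport u).indicator 1 (x - z)) := by
  obtain ⟨L, hL⟩ := hu.lipschitzWith_of_hasCompactSupport hc one_ne_zero
  obtain ⟨B, hB⟩ := hu.continuous.bounded_above_of_compact_support hc
  have hB0 : 0 ≤ B := (norm_nonneg _).trans (hB 0)
  refine ⟨max (L : ℝ) (2 * B), by positivity, fun x z => ?_⟩
  have h1 : |u x - u (x - z)| ≤ max (L : ℝ) (2 * B) * min ‖z‖ 1 := by
    rw [mul_min_of_nonneg _ _ (by positivity)]
    refine le_min ?_ ?_
    · have := hL.dist_le_mul x (x - z)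
      rw [Real.dist_eq, dist_eq_norm, sub_sub_cancel] at this
      refine this.trans ?_
      gcongr
      exact le_max_left _ _
    · rw [mul_one]
      refine le_trans ?_ (le_max_right _ _)
      have := hB x
      have := hB (x - z)
      have := norm_sub_le (u x) (u (x - z))
      rw [Real.norm_eq_abs] at this
      linarith
  have h0 : 0 ≤ max (L : ℝ) (2 * B) * min ‖z‖ 1 := by positivity
  by_cases hx : x ∈ tsupport u
  · rw [indicator_of_mem hx]
    have : (0 : ℝ) ≤ (tsupport u).indicator 1 (x - z) := indicator_nonneg (by simp) _
    simp only [Pi.one_apply]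
    nlinarith
  by_cases hz : x - z ∈ tsupport u
  · rw [indicator_of_mem hz, indicator_of_notMem hx]
    simpa using h1
  · rw [image_eq_zero_of_notMem_tsupport hx, image_eq_zero_of_notMem_tsupport hz,
      indicator_of_notMem hz, indicator_of_notMem hx]
    simp

lemma gradKer_measurable (a : ℝ) (u : E → ℝ) (hu : Continuous u) : Measurable (gradKer a u) := by
  unfold gradKer
  have h1 : Measurable u := hu.measurable
  fun_prop

lemma gradKer_integrable [Nontrivial E] (s : ℝ) (hs0 : 0 < s) (hs1 : s < 1) (u : E → ℝ)
    (hu : ContDiff ℝ 1 u) (hc : HasCompactSupport u) :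
    Integrable (gradKer ((Module.finrank ℝ E : ℝ) + s + 1) u)
      ((volume : Measure E).prod volume) := by
  set a := (Module.finrank ℝ E : ℝ) + s + 1 with ha
  obtain ⟨C, hC, hb⟩ := diff_bound u hu hc
  set S := tsupport u
  have hS : MeasurableSet S := (isClosed_tsupport u).measurableSet
  have hg : Integrable (fun z : E => min (‖z‖ ^ (2 : ℝ)) (‖z‖ ^ (1 : ℝ)) / ‖z‖ ^ a) :=
    integrable_min_rpow 2 1 a (by linarith) (by linarith)
  have hi : Integrable (S.indicator (1 : E → ℝ)) := by
    rw [integrable_indicator_iff hS]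
    exact integrableOn_const (IsCompact.measure_lt_top hc).ne
  have h1 : Integrable (fun w : E × E => S.indicator (1 : E → ℝ) w.1 *
      (min (‖w.2‖ ^ (2 : ℝ)) (‖w.2‖ ^ (1 : ℝ)) / ‖w.2‖ ^ a))
      ((volume : Measure E).prod volume) := hi.mul_prod hg
  have h2 : Integrable (fun w : E × E => S.indicator (1 : E → ℝ) (w.1 - w.2) *
      (min (‖w.2‖ ^ (2 : ℝ)) (‖w.2‖ ^ (1 : ℝ)) / ‖w.2‖ ^ a))
      ((volume : Measure E).prod volume) := by
    have hm := measurePreserving_sub_prod (volume : Measure E) (volume : Measure E)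
    exact (hm.integrable_comp h1.1).2 h1
  refine Integrable.mono' ((h1.add h2).const_mul C)
    (gradKer_measurable a u hu.continuous).aestronglyMeasurable (Eventually.of_forall ?_)
  rintro ⟨x, z⟩
  simp only [gradKer, Pi.add_apply]
  rw [norm_smul, norm_div, Real.norm_eq_abs, Real.norm_of_nonneg (by positivity)]
  have hmin : min (‖z‖ ^ (2 : ℝ)) (‖z‖ ^ (1 : ℝ)) = min ‖z‖ 1 * ‖z‖ := by
    rw [min_mul_of_nonneg _ _ (norm_nonneg z)]
    simp [pow_two]
  rw [hmin]
  calc _ ≤ (C * min ‖z‖ 1 * (S.indicator 1 x + S.indicator 1 (x - z))) / ‖z‖ ^ a * ‖z‖ := by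
        gcongr; exact hb x z
    _ = _ := by ring

/-- the un-normalized fractional gradient -/
noncomputable def fgrad (a : ℝ) (u : E → ℝ) (x : E) : E := ∫ z, gradKer a u (x, z)

lemma fgrad_integrable [Nontrivial E] (s : ℝ) (hs0 : 0 < s) (hs1 : s < 1) (u : E → ℝ)
    (hu : ContDiff ℝ 1 u) (hc : HasCompactSupport u) :
    Integrable (fgrad ((Module.finrank ℝ E : ℝ) + s + 1) u) :=
  (gradKer_integrable s hs0 hs1 u hu hc).integral_prod_left

open Real in
lemma fgrad_fourier [Nontrivial E] (s : ℝ) (hs0 : 0 < s) (hs1 : s < 1) (u : E → ℝ)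
    (hu : ContDiff ℝ 1 u) (hc : HasCompactSupport u) (ξ : E) :
    ∫ y, 𝐞 (-⟪y, ξ⟫) • ((⟪ξ, fgrad ((Module.finrank ℝ E : ℝ) + s + 1) u y⟫ : ℝ) : ℂ) =
    (∫ y, 𝐞 (-⟪y, ξ⟫) • (u y : ℂ)) * (Complex.I *
      ((∫ z : E, (Real.sin (2 * Real.pi * ⟪z, ξ⟫) * ⟪z, ξ⟫) /
      ‖z‖ ^ ((Module.finrank ℝ E : ℝ) + s + 1) : ℝ) : ℂ)) := by
  have hint := gradKer_integrable s hs0 hs1 u hu hc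
  set a := (Module.finrank ℝ E : ℝ) + s + 1 with ha
  -- the complex kernel
  let L : E →L[ℝ] ℂ := Complex.ofRealCLM ∘L (innerSL ℝ ξ)
  have hL : ∀ v, L v = ((⟪ξ, v⟫ : ℝ) : ℂ) := fun v => rfl
  have hint2 : Integrable (fun w : E × E => 𝐞 (-⟪w.1, ξ⟫) • L (gradKer a u w))
      ((volume : Measure E).prod volume) := by
    refine (L.integrable_comp hint).mono ?_ (Eventually.of_forall fun w => ?_)
    · refine AEStronglyMeasurable.fun_smul (Continuous.aestronglyMeasurable ?_)
        (L.integrable_comp hint).1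
      fun_prop
    · rw [Circle.norm_smul]
  have hslice : ∀ᵐ y : E, Integrable (fun z => gradKer a u (y, z)) := hint.prod_right_ae
  have h1 : ∫ y, 𝐞 (-⟪y, ξ⟫) • ((⟪ξ, fgrad a u y⟫ : ℝ) : ℂ) =
      ∫ y, ∫ z, 𝐞 (-⟪y, ξ⟫) • L (gradKer a u (y, z)) := by
    refine integral_congr_ae ?_
    filter_upwards [hslice] with y hy
    simp only [Circle.smul_def]
    rw [integral_smul, ← hL, fgrad, ContinuousLinearMap.integral_comp_comm L hy]
  have huint : Integrable (fun y => (u y : ℂ)) :=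
    (hu.continuous.integrable_of_hasCompactSupport hc).ofReal
  have hF : ∀ z : E, Integrable (fun y => 𝐞 (-⟪y, ξ⟫) • (u (y - z) : ℂ)) := by
    intro z
    refine (huint.comp_sub_right z).mono ?_ (Eventually.of_forall fun w => ?_)
    · refine AEStronglyMeasurable.fun_smul (Continuous.aestronglyMeasurable ?_)
        (huint.comp_sub_right z).1
      fun_prop
    · rw [Circle.norm_smul]
  set U : ℂ := ∫ y, 𝐞 (-⟪y, ξ⟫) • (u y : ℂ) with hU
  have hshift : ∀ z : E, ∫ y, 𝐞 (-⟪y, ξ⟫) • (u (y - z) : ℂ) = (𝐞 (-⟪z, ξ⟫) : ℂ) * U := by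
    intro z
    rw [← integral_add_right_eq_self _ z, hU, ← integral_const_mul]
    congr 1
    ext y
    simp only [add_sub_cancel_right, Circle.smul_def, smul_eq_mul, inner_add_left, neg_add,
      AddChar.map_add_eq_mul, Circle.coe_mul]
    ring
  rw [h1, integral_integral_swap hint2]
  have h3 : ∀ z : E, ∫ y, 𝐞 (-⟪y, ξ⟫) • L (gradKer a u (y, z)) =
      U * ((1 - (𝐞 (-⟪z, ξ⟫) : ℂ)) * ((⟪z, ξ⟫ / ‖z‖ ^ a : ℝ) : ℂ)) := by
    intro z
    have : ∀ y, 𝐞 (-⟪y, ξ⟫) • L (gradKer a u (y, z)) =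
       (𝐞 (-⟪y, ξ⟫) • (u y : ℂ) - 𝐞 (-⟪y, ξ⟫) • (u (y - z) : ℂ)) * ((⟪z, ξ⟫ / ‖z‖ ^ a : ℝ) : ℂ) := by
      intro y
      simp only [gradKer, hL, inner_smul_right, Circle.smul_def, smul_eq_mul, real_inner_comm ξ z]
      push_cast
      ring
    simp_rw [this]
    rw [integral_mul_const, integral_sub (by simpa using hF 0) (hF z), hshift]
    ring
  simp_rw [h3]
  rw [integral_const_mul]
  congr 1
  -- oddness
  set I1 := ∫ z : E, ((1 - (𝐞 (-⟪z, ξ⟫) : ℂ)) * ((⟪z, ξ⟫ / ‖z‖ ^ a : ℝ) : ℂ)) with hI1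
  have hbound : ∀ x : ℝ, ‖(1 - (𝐞 (-x) : ℂ))‖ ≤ 2 * π * min 1 |x| := by
    intro x
    rw [mul_min_of_nonneg _ _ (by positivity)]
    refine le_min ?_ ?_
    · have := norm_sub_le (1 : ℂ) (𝐞 (-x) : ℂ)
      simp only [norm_one, Circle.norm_coe] at this
      linarith [Real.pi_gt_three]
    · have := Real.norm_exp_I_mul_ofReal_sub_one_le (x := 2 * π * (-x))
      rw [Real.fourierChar_apply, norm_sub_rev, mul_comm _ Complex.I]
      refine this.trans ?_
      rw [norm_mul, norm_neg, Real.norm_of_nonneg (by positivity), Real.norm_eq_abs]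
  have hI : Integrable (fun z : E => (1 - (𝐞 (-⟪z, ξ⟫) : ℂ)) * ((⟪z, ξ⟫ / ‖z‖ ^ a : ℝ) : ℂ)) := by
    have hg : Integrable (fun z : E => min (‖z‖ ^ (2 : ℝ)) (‖z‖ ^ (1 : ℝ)) / ‖z‖ ^ a) :=
      integrable_min_rpow 2 1 a (by linarith) (by linarith)
    refine Integrable.mono' (hg.const_mul (2 * π * (‖ξ‖ ^ 2 + ‖ξ‖))) ?_
      (Eventually.of_forall fun z => ?_)
    · have hm : Measurable fun z : E => ⟪z, ξ⟫ := (by fun_prop : Continuous _).measurable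
      have hm2 : Measurable fun z : E => (𝐞 (-⟪z, ξ⟫) : ℂ) :=
        (by fun_prop : Continuous _).measurable
      exact (by fun_prop : Measurable _).aestronglyMeasurable
    · have h4 : |⟪z, ξ⟫| ≤ ‖z‖ * ‖ξ‖ := abs_real_inner_le_norm z ξ
      rw [norm_mul, Complex.norm_real, norm_div, Real.norm_of_nonneg (r := ‖z‖ ^ a) (by positivity),
        Real.norm_eq_abs, ← mul_div_assoc, ← mul_div_assoc]
      refine div_le_div_of_nonneg_right ?_ (by positivity)
      have h5 : min 1 |⟪z, ξ⟫| * |⟪z, ξ⟫| ≤ (‖ξ‖ ^ 2 + ‖ξ‖) * min (‖z‖ ^ (2 : ℝ)) (‖z‖ ^ (1 : ℝ)) := by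
        rw [mul_min_of_nonneg _ _ (by positivity)]
        simp only [Real.rpow_two, Real.rpow_one]
        refine le_min ?_ ?_
        · calc _ ≤ |⟪z, ξ⟫| * |⟪z, ξ⟫| := by gcongr; exact min_le_right _ _
            _ ≤ (‖z‖ * ‖ξ‖) * (‖z‖ * ‖ξ‖) := by gcongr
            _ ≤ _ := by nlinarith [mul_nonneg (norm_nonneg ξ) (sq_nonneg ‖z‖)]
        · calc _ ≤ 1 * |⟪z, ξ⟫| := by gcongr; exact min_le_left _ _
            _ ≤ (‖z‖ * ‖ξ‖) := by linarith
            _ ≤ _ := by nlinarith [mul_nonneg (sq_nonneg ‖ξ‖) (norm_nonneg z)]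
      calc _ ≤ (2 * π * min 1 |⟪z, ξ⟫|) * |⟪z, ξ⟫| := by gcongr; exact hbound _
        _ = 2 * π * (min 1 |⟪z, ξ⟫| * |⟪z, ξ⟫|) := by ring
        _ ≤ 2 * π * ((‖ξ‖ ^ 2 + ‖ξ‖) * min (‖z‖ ^ (2 : ℝ)) (‖z‖ ^ (1 : ℝ))) := by gcongr
        _ = _ := by ring
  have h6 : I1 = ∫ z : E, ((1 - (𝐞 (⟪z, ξ⟫) : ℂ)) * ((-⟪z, ξ⟫ / ‖z‖ ^ a : ℝ) : ℂ)) := by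
    rw [hI1, ← integral_neg_eq_self]
    simp
  have h7 : 2 * I1 = ∫ z : E, (2 * Complex.I) *
      (((Real.sin (2 * Real.pi * ⟪z, ξ⟫) * ⟪z, ξ⟫) / ‖z‖ ^ a : ℝ) : ℂ) := by
    rw [two_mul]
    nth_rewrite 2 [h6]
    rw [hI1, ← integral_add hI]
    · congr 1
      ext z
      simp only [Real.fourierChar_apply]
      push_cast
      rw [Complex.sin]
      ring_nf
      simp only [Complex.I_sq]
      ring_nf
    · have := hI.comp_neg
      simpa using this
  rw [integral_const_mul, integral_complex_ofReal] at h7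
  have : (2 : ℂ) ≠ 0 := two_ne_zero
  apply mul_left_cancel₀ this
  rw [h7]
  ring
end B
end Part1

section Part2
open MeasureTheory Filter Set
open scoped RealInnerProductSpace FourierTransform SchwartzMap ENNReal

section C
variable {E : Type*} [NormedAddCommGroup E] [InnerProductSpace ℝ E] [FiniteDimensional ℝ E]
  [MeasurableSpace E] [BorelSpace E]
variable {V : Type*} [NormedAddCommGroup V] [NormedSpace ℝ V]

lemma fourierInv_apply_vec (Ψ : 𝓢(E, V →L[ℝ] ℂ)) (w : E) (v : V) :
    (𝓕⁻ Ψ) w v = ∫ ξ, 𝐞 ⟪ξ, w⟫ • Ψ ξ v := by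
  rw [SchwartzMap.fourierInv_coe, Real.fourierInv_eq, ContinuousLinearMap.integral_apply]
  · rfl
  · exact (Real.fourierIntegral_convergent_iff' (μ := volume) (innerSL ℝ) (-w)).2 Ψ.integrable |>.congr
      (Eventually.of_forall fun z => by
        have : (innerSL ℝ z) w = ⟪z, w⟫ := rfl
        simp [this])

lemma conv_eq_fourier (Ψ : 𝓢(E, V →L[ℝ] ℂ)) (G : E → V) (hG : Integrable G) (x : E) :
    ∫ y, (𝓕⁻ Ψ) (x - y) (G y) = ∫ ξ, 𝐞 ⟪x, ξ⟫ • ∫ y, 𝐞 (-⟪y, ξ⟫) • Ψ ξ (G y) := by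
  have hint : Integrable (fun w : E × E => 𝐞 (⟪w.2, x - w.1⟫) • Ψ w.2 (G w.1))
      ((volume : Measure E).prod volume) := by
    have h0 : Integrable (fun w : E × E => ‖G w.1‖ * ‖Ψ w.2‖) ((volume : Measure E).prod volume) :=
      hG.norm.mul_prod Ψ.integrable.norm
    refine Integrable.mono' h0 ?_ (Eventually.of_forall fun w => ?_)
    · refine AEStronglyMeasurable.fun_smul (Continuous.aestronglyMeasurable (by fun_prop)) ?_
      have h1 : AEStronglyMeasurable (fun w : E × E => Ψ w.2) ((volume : Measure E).prod volume) :=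
        Continuous.aestronglyMeasurable (by fun_prop)
      have h2 : AEStronglyMeasurable (fun w : E × E => G w.1) ((volume : Measure E).prod volume) :=
        hG.1.comp_fst
      exact (isBoundedBilinearMap_apply (𝕜 := ℝ) (E := V) (F := ℂ)).continuous.comp_aestronglyMeasurable
        (h1.prodMk h2)
    · rw [Circle.norm_smul, mul_comm]
      exact (Ψ w.2).le_opNorm _
  simp_rw [fourierInv_apply_vec]
  rw [integral_integral_swap hint]
  congr 1
  ext ξ
  simp only [Circle.smul_def]
  rw [← integral_smul]
  congr 1
  ext y
  rw [smul_smul, ← Circle.coe_mul, ← AddChar.map_add_eq_mul, inner_sub_right, real_inner_comm ξ x,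
    real_inner_comm ξ y, sub_eq_add_neg]

lemma fourierInv_scale (Ψ Ψ' : 𝓢(E, V →L[ℝ] ℂ)) (R : ℝ) (hR : 0 < R)
    (h : ∀ ξ, Ψ' ξ = Ψ (R⁻¹ • ξ)) (w : E) :
    (𝓕⁻ Ψ') w = (R ^ Module.finrank ℝ E) • (𝓕⁻ Ψ) (R • w) := by
  rw [SchwartzMap.fourierInv_coe, SchwartzMap.fourierInv_coe, Real.fourierInv_eq,
    Real.fourierInv_eq]
  have := Measure.integral_comp_inv_smul (volume : Measure E)
    (fun ξ => 𝐞 ⟪ξ, R • w⟫ • Ψ ξ) R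
  rw [abs_of_nonneg (by positivity)] at this
  rw [← this]
  congr 1
  ext1 ξ
  rw [h, real_inner_smul_right, real_inner_smul_left, mul_inv_cancel_left₀ hR.ne']

lemma eLpNorm_scale {W : Type*} [NormedAddCommGroup W] [NormedSpace ℝ W] (k : E → W)
    (hk : Continuous k) (R : ℝ) (hR : 0 < R) (r : ℝ) (hr : 0 < r) :
    eLpNorm (fun w => (R ^ Module.finrank ℝ E) • k (R • w)) (ENNReal.ofReal r) volume =
      ENNReal.ofReal (R ^ ((Module.finrank ℝ E : ℝ) * (1 - 1 / r))) *
        eLpNorm k (ENNReal.ofReal r) volume := by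
  have h1 : eLpNorm (fun w => k (R • w)) (ENNReal.ofReal r) (volume : Measure E) =
      ENNReal.ofReal (R ^ (-(Module.finrank ℝ E : ℝ) / r)) * eLpNorm k (ENNReal.ofReal r) volume := by
    have hm := eLpNorm_map_measure (μ := (volume : Measure E)) (f := fun w => R • w) (g := k)
      (p := ENNReal.ofReal r) hk.aestronglyMeasurable (by fun_prop)
    have h2 := Measure.map_addHaar_smul (volume : Measure E) hR.ne'
    rw [h2, eLpNorm_smul_measure_of_ne_top (by simp)] at hm
    rw [Function.comp_def] at hm
    rw [← hm, smul_eq_mul, ENNReal.toReal_div, ENNReal.toReal_one, ENNReal.toReal_ofReal hr.le, abs_of_nonneg (by positivity)]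
    congr 1
    rw [ENNReal.ofReal_rpow_of_pos (by positivity), ← Real.rpow_natCast, ← Real.rpow_neg hR.le,
      ← Real.rpow_mul hR.le]
    congr 2
    ring
  have h3 : (fun w => (R ^ Module.finrank ℝ E) • k (R • w)) =
      (R ^ Module.finrank ℝ E) • (fun w => k (R • w)) := rfl
  rw [h3, eLpNorm_const_smul, h1, ← mul_assoc, Real.enorm_eq_ofReal (by positivity),
    ← ENNReal.ofReal_mul (by positivity)]
  congr 2
  rw [← Real.rpow_natCast, ← Real.rpow_add hR]
  congr 1
  ring

lemma young_lintegral (f g : E → ℝ≥0∞) (hf : Measurable f) (hg : AEMeasurable g)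
    (p p' : ℝ) (hpp : p.HolderConjugate p') :
    ∫⁻ x, (∫⁻ y, f (x - y) * g y) ^ p ≤ (∫⁻ w, f w) ^ p * ∫⁻ y, g y ^ p := by
  have hp0 := hpp.pos
  have hp0' := hpp.symm.pos
  have hsum : 1 / p' + 1 / p = 1 := by
    have := hpp.symm.inv_add_inv_eq_one
    simpa [one_div] using this
  have key : ∀ x, (∫⁻ y, f (x - y) * g y) ^ p ≤
      (∫⁻ w, f w) ^ (p / p') * ∫⁻ y, f (x - y) * g y ^ p := by
    intro x
    have hfx : Measurable fun y => f (x - y) := by fun_prop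
    have h := ENNReal.lintegral_mul_le_Lp_mul_Lq (volume : Measure E) hpp.symm
      (f := fun y => f (x - y) ^ (1 / p')) (g := fun y => f (x - y) ^ (1 / p) * g y)
      (by fun_prop) (by fun_prop)
    have e1 : ∀ y, ((fun y => f (x - y) ^ (1 / p')) * (fun y => f (x - y) ^ (1 / p) * g y)) y =
        f (x - y) * g y := by
      intro y
      simp only [Pi.mul_apply]
      rw [← mul_assoc, ← ENNReal.rpow_add_of_nonneg _ _ (by positivity) (by positivity), hsum,
        ENNReal.rpow_one]
    have e2 : ∀ y, (f (x - y) ^ (1 / p')) ^ p' = f (x - y) := by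
      intro y
      rw [← ENNReal.rpow_mul, one_div, inv_mul_cancel₀ hp0'.ne', ENNReal.rpow_one]
    have e3 : ∀ y, (f (x - y) ^ (1 / p) * g y) ^ p = f (x - y) * g y ^ p := by
      intro y
      rw [ENNReal.mul_rpow_of_nonneg _ _ hp0.le, ← ENNReal.rpow_mul, one_div,
        inv_mul_cancel₀ hp0.ne', ENNReal.rpow_one]
    simp_rw [e1, e2, e3] at h
    have e4 : ∫⁻ y, f (x - y) = ∫⁻ w, f w := lintegral_sub_left_eq_self f x
    rw [e4] at h
    calc _ ≤ ((∫⁻ w, f w) ^ (1 / p') * (∫⁻ y, f (x - y) * g y ^ p) ^ (1 / p)) ^ p := by gcongr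
      _ = _ := by
        rw [ENNReal.mul_rpow_of_nonneg _ _ hp0.le, ← ENNReal.rpow_mul, ← ENNReal.rpow_mul,
          one_div_mul_cancel hp0.ne', ENNReal.rpow_one]
        congr 2
        ring
  calc _ ≤ ∫⁻ x, (∫⁻ w, f w) ^ (p / p') * ∫⁻ y, f (x - y) * g y ^ p := lintegral_mono key
    _ = (∫⁻ w, f w) ^ (p / p') * ∫⁻ x, ∫⁻ y, f (x - y) * g y ^ p := by
        have hm : AEMeasurable (fun w : E × E => f (w.1 - w.2) * g w.2 ^ p)
            ((volume : Measure E).prod volume) := by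
          have : AEMeasurable (fun w : E × E => g w.2) ((volume : Measure E).prod volume) :=
            hg.comp_snd
          fun_prop
        rw [lintegral_const_mul'' _ hm.lintegral_prod_right']
    _ = (∫⁻ w, f w) ^ (p / p') * ∫⁻ y, ∫⁻ x, f (x - y) * g y ^ p := by
        congr 1
        apply lintegral_lintegral_swap
        have : AEMeasurable (fun w : E × E => g w.2) ((volume : Measure E).prod volume) :=
            hg.comp_snd
        fun_prop
    _ = (∫⁻ w, f w) ^ (p / p') * ((∫⁻ w, f w) * ∫⁻ y, g y ^ p) := by
        congr 1
        rw [← lintegral_const_mul'' _ (by fun_prop)]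
        congr 1
        ext y
        rw [lintegral_mul_const _ (by fun_prop), lintegral_sub_right_eq_self f y]
    _ = _ := by
        rw [← mul_assoc]
        congr 1
        nth_rewrite 2 [← ENNReal.rpow_one (∫⁻ w, f w)]
        rw [← ENNReal.rpow_add_of_nonneg _ _ (by positivity) zero_le_one]
        congr 1
        have := hpp.div_conj_eq_sub_one
        linarith

lemma conv_sup_le (k : E → V →L[ℝ] ℂ) (hk : Continuous k) (G : E → V)
    (hG : AEStronglyMeasurable G) (p p' : ℝ) (hpp : p.HolderConjugate p') (x : E) :
    ‖∫ y, k (x - y) (G y)‖ₑ ≤ eLpNorm k (ENNReal.ofReal p') volume *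
      eLpNorm G (ENNReal.ofReal p) volume := by
  have hp0 := hpp.pos
  have hp0' := hpp.symm.pos
  have hkm : Measurable fun w => ‖k w‖ₑ := hk.enorm.measurable
  calc _ ≤ ∫⁻ y, ‖k (x - y) (G y)‖ₑ := enorm_integral_le_lintegral_enorm _
    _ ≤ ∫⁻ y, ((fun y => ‖k (x - y)‖ₑ) * (fun y => ‖G y‖ₑ)) y :=
        lintegral_mono fun y => (k (x - y)).le_opENorm (G y)
    _ ≤ _ := ENNReal.lintegral_mul_le_Lp_mul_Lq (volume : Measure E) hpp.symm
        (by fun_prop) hG.enorm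
    _ = _ := by
      rw [eLpNorm_eq_lintegral_rpow_enorm_toReal (by simpa using hp0') (by simp),
        eLpNorm_eq_lintegral_rpow_enorm_toReal (by simpa using hp0) (by simp),
        ENNReal.toReal_ofReal hp0.le, ENNReal.toReal_ofReal hp0'.le]
      congr 2
      exact lintegral_sub_left_eq_self (fun w => ‖k w‖ₑ ^ p') x

lemma conv_Lp_le (k : E → V →L[ℝ] ℂ) (hk : Continuous k) (G : E → V)
    (hG : AEStronglyMeasurable G) (p p' : ℝ) (hpp : p.HolderConjugate p') :
    eLpNorm (fun x => ∫ y, k (x - y) (G y)) (ENNReal.ofReal p) volume ≤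
      eLpNorm k (ENNReal.ofReal 1) volume * eLpNorm G (ENNReal.ofReal p) volume := by
  have hp0 := hpp.pos
  have hkm : Measurable fun w => ‖k w‖ₑ := hk.enorm.measurable
  rw [ENNReal.ofReal_one, eLpNorm_one_eq_lintegral_enorm,
    eLpNorm_eq_lintegral_rpow_enorm_toReal (by simpa using hp0) (by simp),
    eLpNorm_eq_lintegral_rpow_enorm_toReal (by simpa using hp0) (by simp),
    ENNReal.toReal_ofReal hp0.le]
  calc _ ≤ (∫⁻ x, (∫⁻ y, ‖k (x - y)‖ₑ * ‖G y‖ₑ) ^ p) ^ (1 / p) := by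
        gcongr with x
        refine (enorm_integral_le_lintegral_enorm _).trans ?_
        exact lintegral_mono fun y => (k (x - y)).le_opENorm (G y)
    _ ≤ ((∫⁻ w, ‖k w‖ₑ) ^ p * ∫⁻ y, ‖G y‖ₑ ^ p) ^ (1 / p) := by
        gcongr
        exact young_lintegral _ _ hkm hG.enorm p p' hpp
    _ = _ := by
        rw [ENNReal.mul_rpow_of_nonneg _ _ (by positivity), ← ENNReal.rpow_mul,
          mul_one_div_cancel hp0.ne', ENNReal.rpow_one]

lemma interp_Lq (H : E → ℂ) (A B : ℝ≥0∞) (p q : ℝ) (hp : 0 < p) (hpq : p ≤ q)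
    (hA' : A ≠ ⊤) (hA : ∀ x, ‖H x‖ₑ ≤ A) (hB : eLpNorm H (ENNReal.ofReal p) volume ≤ B) :
    eLpNorm H (ENNReal.ofReal q) volume ≤ A ^ (1 - p / q) * B ^ (p / q) := by
  have hq : 0 < q := hp.trans_le hpq
  rw [eLpNorm_eq_lintegral_rpow_enorm_toReal (by simpa using hp) (by simp),
    ENNReal.toReal_ofReal hp.le] at hB
  rw [eLpNorm_eq_lintegral_rpow_enorm_toReal (by simpa using hq) (by simp),
    ENNReal.toReal_ofReal hq.le]
  calc _ ≤ (A ^ (q - p) * ∫⁻ x, ‖H x‖ₑ ^ p) ^ (1 / q) := by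
        gcongr
        rw [← lintegral_const_mul' _ _ (ENNReal.rpow_ne_top_of_nonneg (by linarith) hA')]
        refine lintegral_mono fun x => ?_
        dsimp only
        have : ‖H x‖ₑ ^ q = ‖H x‖ₑ ^ (q - p) * ‖H x‖ₑ ^ p := by
          rw [← ENNReal.rpow_add_of_nonneg _ _ (by linarith) hp.le]; congr 1; ring
        rw [this]
        have : 0 ≤ q - p := by linarith
        gcongr
        exact hA x
    _ = A ^ (1 - p / q) * ((∫⁻ x, ‖H x‖ₑ ^ p) ^ (1 / p)) ^ (p / q) := by
        rw [ENNReal.mul_rpow_of_nonneg _ _ (by positivity), ← ENNReal.rpow_mul,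
          ← ENNReal.rpow_mul]
        congr 2 <;> field_simp
    _ ≤ _ := by gcongr
end C
end Part2

section Part3
open MeasureTheory Filter Set
open scoped RealInnerProductSpace FourierTransform SchwartzMap ENNReal ContDiff

section D
set_option linter.unusedSectionVars false
variable {E : Type*} [NormedAddCommGroup E] [InnerProductSpace ℝ E] [FiniteDimensional ℝ E]
  [MeasurableSpace E] [BorelSpace E]

lemma schwartz_ne_top {F : Type*} [NormedAddCommGroup F] [NormedSpace ℝ F] (k : 𝓢(E, F))
    (p : ℝ≥0∞) : eLpNorm k p volume ≠ ⊤ := (k.eLpNorm_lt_top p volume).ne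

/-- the frequency cut-off -/
noncomputable def cutBump (E : Type*) [NormedAddCommGroup E] [InnerProductSpace ℝ E] :
    ContDiffBump (0 : E) := ⟨1, 2, one_pos, one_lt_two⟩

/-- the frequency cut-off at scale `R` -/
noncomputable def cut (R : ℝ) (ξ : E) : ℝ := cutBump E (R⁻¹ • ξ)

lemma cut_contDiff (R : ℝ) : ContDiff ℝ ∞ (cut R : E → ℝ) := by
  unfold cut
  exact (cutBump E).contDiff.comp (by fun_prop)

lemma cut_support (R : ℝ) (hR : 0 < R) : HasCompactSupport (cut R : E → ℝ) := by
  unfold cut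
  exact (cutBump E).hasCompactSupport.comp_homeomorph
    (Homeomorph.smulOfNeZero R⁻¹ (inv_ne_zero hR.ne'))

lemma cut_abs_le (R : ℝ) (ξ : E) : |cut R ξ| ≤ 1 := by
  unfold cut
  rw [abs_of_nonneg (cutBump E).nonneg]
  exact (cutBump E).le_one

lemma cut_eq_one (R : ℝ) (hR : 0 < R) (ξ : E) (h : ‖ξ‖ ≤ R) : cut R ξ = 1 := by
  unfold cut
  apply (cutBump E).one_of_mem_closedBall
  simp only [cutBump, mem_closedBall_zero_iff, norm_smul, norm_inv, Real.norm_of_nonneg hR.le]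
  rw [inv_mul_le_iff₀ hR]; simpa using h

lemma cut_scale (R t : ℝ) (hR : 0 < R) (ξ : E) : cut t (R⁻¹ • ξ) = cut (t * R) ξ := by
  unfold cut
  rw [smul_smul, mul_inv]

/-- low frequency multiplier -/
noncomputable def lowFun (R : ℝ) (ξ : E) : ℝ →L[ℝ] ℂ := cut R ξ • Complex.ofRealCLM

lemma lowFun_contDiff (R : ℝ) : ContDiff ℝ ∞ (lowFun R : E → ℝ →L[ℝ] ℂ) :=
  (cut_contDiff R).smul contDiff_const

lemma lowFun_support (R : ℝ) (hR : 0 < R) : HasCompactSupport (lowFun R : E → ℝ →L[ℝ] ℂ) := by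
  refine (cut_support R hR).mono ?_
  intro ξ hξ
  contrapose! hξ
  simp only [Function.mem_support, not_not] at hξ ⊢
  rw [lowFun, hξ]
  ext v; simp

/-- low frequency multiplier as a Schwartz function -/
noncomputable def lowPsi (R : ℝ) (hR : 0 < R) : 𝓢(E, ℝ →L[ℝ] ℂ) :=
  HasCompactSupport.toSchwartzMap (lowFun_support R hR) (lowFun_contDiff R)

/-- high frequency multiplier function -/
noncomputable def highFun (s : ℝ) (ξ : E) : E →L[ℝ] ℂ :=
  ((cut 2 ξ - cut 1 ξ) / ‖ξ‖ ^ (1 + s)) • (Complex.ofRealCLM ∘L (innerSL ℝ ξ))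

lemma highFun_contDiff (s : ℝ) : ContDiff ℝ ∞ (highFun s : E → E →L[ℝ] ℂ) := by
  rw [contDiff_iff_contDiffAt]
  intro ξ
  by_cases hξ : ‖ξ‖ < 1
  · have : (highFun s : E → E →L[ℝ] ℂ) =ᶠ[nhds ξ] fun _ => 0 := by
      have hopen : IsOpen {ξ : E | ‖ξ‖ < 1} := isOpen_lt continuous_norm continuous_const
      filter_upwards [hopen.mem_nhds hξ] with η hη
      have hη : ‖η‖ < 1 := hη
      rw [highFun, cut_eq_one 1 one_pos η hη.le, cut_eq_one 2 two_pos η (by linarith), sub_self, zero_div]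
      ext v; simp
    exact contDiffAt_const.congr_of_eventuallyEq this
  · have h0 : ξ ≠ 0 := by rintro rfl; simp at hξ
    have hn : ContDiffAt ℝ ∞ (fun ξ : E => ‖ξ‖ ^ (1 + s)) ξ :=
      (contDiffAt_norm ℝ h0).rpow_const_of_ne (by simpa using h0)
    refine ContDiffAt.smul (ContDiffAt.div ?_ hn ?_) ?_
    · exact ((cut_contDiff 2).sub (cut_contDiff 1)).contDiffAt
    · have : 0 < ‖ξ‖ := norm_pos_iff.2 h0
      positivity
    · exact (contDiff_const.clm_comp (innerSL ℝ (E := E)).contDiff).contDiffAt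

lemma highFun_support (s : ℝ) : HasCompactSupport (highFun s : E → E →L[ℝ] ℂ) := by
  have h1 : HasCompactSupport (fun ξ : E => cut 2 ξ - cut 1 ξ) :=
    (cut_support 2 two_pos).sub (cut_support 1 one_pos)
  refine h1.mono ?_
  intro ξ hξ
  contrapose! hξ
  simp only [Function.mem_support, not_not] at hξ ⊢
  rw [highFun, hξ, zero_div]
  ext v; simp

/-- high frequency multiplier at scale `R` -/
noncomputable def highPsi (s R : ℝ) (hR : 0 < R) : 𝓢(E, E →L[ℝ] ℂ) :=
  HasCompactSupport.toSchwartzMap (f := fun ξ => highFun s (R⁻¹ • ξ))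
    ((highFun_support s).comp_homeomorph (Homeomorph.smulOfNeZero R⁻¹ (inv_ne_zero hR.ne')))
    ((highFun_contDiff s).comp (by fun_prop))

/-- smooth compactly supported functions as complex valued Schwartz functions -/
noncomputable def toS (u : E → ℝ) (hu : ContDiff ℝ ∞ u) (hc : HasCompactSupport u) : 𝓢(E, ℂ) :=
  HasCompactSupport.toSchwartzMap (f := fun x => (u x : ℂ))
    (hc.comp_left (g := fun t : ℝ => (t : ℂ)) Complex.ofReal_zero)
    (Complex.ofRealCLM.contDiff.comp hu)

/-- Littlewood-Paley projection -/
noncomputable def lpS (R : ℝ) (f : 𝓢(E, ℂ)) (x : E) : ℂ :=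
  ∫ ξ, 𝐞 ⟪x, ξ⟫ • ((cut R ξ : ℂ) * (𝓕 f) ξ)

lemma toS_fourier (u : E → ℝ) (hu : ContDiff ℝ ∞ u) (hc : HasCompactSupport u) (ξ : E) :
    (𝓕 (toS u hu hc)) ξ = ∫ y, 𝐞 (-⟪y, ξ⟫) • (u y : ℂ) := by
  rw [SchwartzMap.fourier_coe, Real.fourier_eq]
  rfl

lemma lpS_integrable (R : ℝ) (f : 𝓢(E, ℂ)) (x : E) :
    Integrable (fun ξ => 𝐞 ⟪x, ξ⟫ • ((cut R ξ : ℂ) * (𝓕 f) ξ)) := by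
  have hcont : Continuous (cut R : E → ℝ) := (cut_contDiff R).continuous
  refine (𝓕 f).integrable.mono (Continuous.aestronglyMeasurable ?_)
    (Eventually.of_forall fun ξ => ?_)
  · have := (𝓕 f).continuous
    fun_prop
  · rw [Circle.norm_smul, norm_mul, Complex.norm_real, Real.norm_eq_abs]
    exact mul_le_of_le_one_left (norm_nonneg _) (cut_abs_le R ξ)

lemma lpS_continuous (R : ℝ) (f : 𝓢(E, ℂ)) : Continuous (lpS R f) := by
  unfold lpS
  refine continuous_of_dominated (bound := fun ξ => ‖(𝓕 f) ξ‖)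
    (fun x => (lpS_integrable R f x).1) (fun x => Eventually.of_forall fun ξ => ?_)
    (𝓕 f).integrable.norm (Eventually.of_forall fun ξ => by fun_prop)
  rw [Circle.norm_smul, norm_mul, Complex.norm_real, Real.norm_eq_abs]
  exact mul_le_of_le_one_left (norm_nonneg _) (cut_abs_le R ξ)

lemma lpS_tendsto (f : 𝓢(E, ℂ)) (x : E) :
    Tendsto (fun N : ℕ => lpS (2 ^ N) f x) atTop (nhds (f x)) := by
  have h1 : f x = ∫ ξ, 𝐞 ⟪x, ξ⟫ • (𝓕 f) ξ := by
    have : (𝓕⁻ (𝓕 f)) = f := FourierTransform.fourierInv_fourier_eq f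
    conv_lhs => rw [← this, SchwartzMap.fourierInv_coe, Real.fourierInv_eq]
    simp_rw [real_inner_comm]
  rw [h1]
  unfold lpS
  refine tendsto_integral_of_dominated_convergence (fun ξ => ‖(𝓕 f) ξ‖)
    (fun N => (lpS_integrable _ f x).1) (𝓕 f).integrable.norm
    (fun N => Eventually.of_forall fun ξ => ?_) (Eventually.of_forall fun ξ => ?_)
  · rw [Circle.norm_smul, norm_mul, Complex.norm_real, Real.norm_eq_abs]
    exact mul_le_of_le_one_left (norm_nonneg _) (cut_abs_le _ ξ)
  · refine tendsto_const_nhds.congr' ?_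
    have ht : Tendsto (fun N : ℕ => (2 : ℝ) ^ N) atTop atTop :=
      tendsto_pow_atTop_atTop_of_one_lt one_lt_two
    filter_upwards [ht.eventually_ge_atTop ‖ξ‖] with N hN
    rw [cut_eq_one _ (by positivity) ξ hN]
    simp

lemma lpS_eq_low (R : ℝ) (hR : 0 < R) (u : E → ℝ) (hu : ContDiff ℝ ∞ u)
    (hc : HasCompactSupport u) (x : E) :
    lpS R (toS u hu hc) x = ∫ y, (𝓕⁻ (lowPsi R hR : 𝓢(E, ℝ →L[ℝ] ℂ))) (x - y) (u y) := by
  rw [conv_eq_fourier _ _ (hu.continuous.integrable_of_hasCompactSupport hc)]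
  unfold lpS
  congr 1
  ext ξ
  congr 1
  rw [toS_fourier, ← integral_const_mul]
  congr 1
  ext y
  have : (lowPsi R hR : 𝓢(E, ℝ →L[ℝ] ℂ)) ξ (u y) = (cut R ξ : ℂ) * (u y : ℂ) := by
    change (cut R ξ • Complex.ofRealCLM) (u y) = _
    simp
  rw [this, Circle.smul_def, Circle.smul_def, smul_eq_mul, smul_eq_mul]
  ring

lemma exists_high_identity [Nontrivial E] (s : ℝ) (hs0 : 0 < s) (hs1 : s < 1) :
    ∃ κ : ℝ, 0 < κ ∧ ∀ (R : ℝ) (hR : 0 < R) (u : E → ℝ) (hu : ContDiff ℝ ∞ u)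
      (hc : HasCompactSupport u) (x : E),
      ∫ y, (𝓕⁻ (highPsi s R hR : 𝓢(E, E →L[ℝ] ℂ))) (x - y)
        (fgrad ((Module.finrank ℝ E : ℝ) + s + 1) u y) =
      (Complex.I * ((κ * R ^ s : ℝ) : ℂ)) *
        (lpS (2 * R) (toS u hu hc) x - lpS R (toS u hu hc) x) := by
  obtain ⟨κ, hκ, hsym⟩ := exists_symbol (E := E) s hs0 hs1
  refine ⟨κ, hκ, fun R hR u hu hc x => ?_⟩
  have hu1 : ContDiff ℝ 1 u := hu.of_le (by simp)
  rw [conv_eq_fourier _ _ (fgrad_integrable s hs0 hs1 u hu1 hc)]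
  unfold lpS
  rw [← integral_sub (lpS_integrable _ _ _) (lpS_integrable _ _ _), ← integral_const_mul]
  congr 1
  ext ξ
  rw [toS_fourier]
  have h1 : ∀ v : E, (highPsi s R hR : 𝓢(E, E →L[ℝ] ℂ)) ξ v =
      ((((cut (2 * R) ξ - cut R ξ) / ‖R⁻¹ • ξ‖ ^ (1 + s)) * R⁻¹ : ℝ) : ℂ) * ((⟪ξ, v⟫ : ℝ) : ℂ) := by
    intro v
    change highFun s (R⁻¹ • ξ) v = _
    rw [highFun, cut_scale R 2 hR, cut_scale R 1 hR, one_mul]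
    simp only [_root_.smul_apply, ContinuousLinearMap.comp_apply, innerSL_apply_apply,
      Complex.ofRealCLM_apply, real_inner_smul_left, Complex.real_smul]
    push_cast
    ring
  have h2 : ∫ y, 𝐞 (-⟪y, ξ⟫) • (highPsi s R hR : 𝓢(E, E →L[ℝ] ℂ)) ξ
      (fgrad ((Module.finrank ℝ E : ℝ) + s + 1) u y) =
      ((((cut (2 * R) ξ - cut R ξ) / ‖R⁻¹ • ξ‖ ^ (1 + s)) * R⁻¹ : ℝ) : ℂ) *
      ∫ y, 𝐞 (-⟪y, ξ⟫) • ((⟪ξ, fgrad ((Module.finrank ℝ E : ℝ) + s + 1) u y⟫ : ℝ) : ℂ) := by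
    rw [← integral_const_mul]
    congr 1
    ext y
    rw [h1, Circle.smul_def, Circle.smul_def, smul_eq_mul, smul_eq_mul]
    ring
  rw [h2, fgrad_fourier s hs0 hs1 u hu1 hc ξ, hsym]
  have h3 : (((cut (2 * R) ξ - cut R ξ) / ‖R⁻¹ • ξ‖ ^ (1 + s)) * R⁻¹) * (κ * ‖ξ‖ ^ (1 + s)) =
      κ * R ^ s * (cut (2 * R) ξ - cut R ξ) := by
    rcases eq_or_ne ξ 0 with rfl | hξ
    · rw [cut_eq_one _ hR _ (by simpa using hR.le), cut_eq_one _ (by positivity) _ (by simpa using hR.le)]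
      simp
    · have hn : 0 < ‖ξ‖ := norm_pos_iff.2 hξ
      rw [norm_smul, Real.norm_of_nonneg (by positivity), Real.mul_rpow (by positivity) hn.le,
        Real.inv_rpow hR.le, Real.rpow_add hR, Real.rpow_one]
      have : 0 < ‖ξ‖ ^ (1 + s) := by positivity
      have : 0 < R ^ s := by positivity
      field_simp
  have h4 : ((((cut (2 * R) ξ - cut R ξ) / ‖R⁻¹ • ξ‖ ^ (1 + s)) * R⁻¹ : ℝ) : ℂ) *
      ((κ * ‖ξ‖ ^ (1 + s) : ℝ) : ℂ) = ((κ * R ^ s : ℝ) : ℂ) * ((cut (2 * R) ξ : ℂ) - (cut R ξ : ℂ)) := by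
    rw [← Complex.ofReal_mul, h3]
    push_cast
    ring
  simp only [Circle.smul_def, smul_eq_mul]
  linear_combination ((𝐞 ⟪x, ξ⟫ : ℂ) * (∫ y, (𝐞 (-⟪y, ξ⟫) : ℂ) * (u y : ℂ)) * Complex.I) * h4

lemma high_bound_aux (s p p' q : ℝ) (hpp : p.HolderConjugate p')
    (hsp : s * p = Module.finrank ℝ E) (hpq : p ≤ q) (a : ℝ≥0∞) (ha : a ≠ ⊤)
    (κ : ℝ) (hκ : 0 < κ) (k kR : E → E →L[ℝ] ℂ) (hk : Continuous k) (hkc : Continuous kR)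
    (R : ℝ) (hR : 0 < R)
    (hkR' : kR = fun w => (R ^ Module.finrank ℝ E) • k (R • w))
    (K1 K2 : ℝ≥0∞) (hK1 : eLpNorm k (ENNReal.ofReal 1) volume = K1)
    (hK2 : eLpNorm k (ENNReal.ofReal p') volume = K2) (hK2t : K2 ≠ ⊤)
    (F : E → E) (hF : AEStronglyMeasurable F volume)
    (hFa : eLpNorm F (ENNReal.ofReal p) volume ≤ a) (g : E → ℂ)
    (hid : ∀ x, ∫ y, kR (x - y) (F y) = (Complex.I * ((κ * R ^ s : ℝ) : ℂ)) * g x) :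
    eLpNorm g (ENNReal.ofReal q) volume ≤
      (ENNReal.ofReal κ⁻¹ * (K2 * a)) ^ (1 - p / q) * (ENNReal.ofReal κ⁻¹ * (K1 * a)) ^ (p / q)
       * ENNReal.ofReal (R ^ (-(s * p / q))) := by
  have hp0 := hpp.pos
  have hp0' := hpp.symm.pos
  have hq : 0 < q := hp0.trans_le hpq
  have hκ' : ENNReal.ofReal κ⁻¹ ≠ ⊤ := by simp
  have hn1 : eLpNorm kR (ENNReal.ofReal 1) volume = K1 := by
    rw [hkR', eLpNorm_scale k hk R hR 1 one_pos]
    simpa using hK1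
  have hn2 : eLpNorm kR (ENNReal.ofReal p') volume = ENNReal.ofReal (R ^ s) * K2 := by
    rw [hkR', eLpNorm_scale k hk R hR p' hp0', hK2]
    congr 3
    have : 1 - 1 / p' = 1 / p := by
      have := hpp.inv_add_inv_eq_one
      rw [one_div, one_div]; linarith
    rw [this, ← hsp]
    field_simp
  obtain ⟨c, hc'⟩ : ∃ c : ℂ, c = (Complex.I * ((κ * R ^ s : ℝ) : ℂ)) := ⟨_, rfl⟩
  rw [← hc'] at hid
  have hRs : 0 < R ^ s := by positivity
  have hc0 : c ≠ 0 := by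
    rw [hc']
    exact mul_ne_zero Complex.I_ne_zero (Complex.ofReal_ne_zero.2 (mul_pos hκ hRs).ne')
  have hcn : ‖c⁻¹‖ₑ = ENNReal.ofReal κ⁻¹ * ENNReal.ofReal (R ^ (-s)) := by
    rw [← ENNReal.ofReal_mul (by positivity), ← ofReal_norm]
    congr 1
    rw [norm_inv, hc', norm_mul, Complex.norm_I, one_mul, Complex.norm_real,
      Real.norm_of_nonneg (by positivity), mul_inv, Real.rpow_neg hR.le]
  have hdiff : g = c⁻¹ • (fun x => ∫ y, kR (x - y) (F y)) := by
    ext x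
    simp only [Pi.smul_apply, smul_eq_mul]
    rw [hid x, inv_mul_cancel_left₀ hc0]
  have hsup : ∀ x, ‖g x‖ₑ ≤ ENNReal.ofReal κ⁻¹ * (K2 * a) := by
    intro x
    have h1 := congrFun hdiff x
    have h2 := conv_sup_le kR hkc F hF p p' hpp x
    rw [h1, Pi.smul_apply, enorm_smul, hcn]
    calc _ ≤ ENNReal.ofReal κ⁻¹ * ENNReal.ofReal (R ^ (-s)) *
          (ENNReal.ofReal (R ^ s) * K2 * a) := by
          refine mul_le_mul_right (h2.trans ?_) _
          rw [hn2]
          exact mul_le_mul_right hFa _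
      _ = ENNReal.ofReal κ⁻¹ * (ENNReal.ofReal (R ^ (-s)) * ENNReal.ofReal (R ^ s)) * (K2 * a) := by
          ring
      _ = _ := by
          rw [← ENNReal.ofReal_mul (by positivity), ← Real.rpow_add hR]
          simp
  have hLp : eLpNorm g
      (ENNReal.ofReal p) volume ≤ ENNReal.ofReal (R ^ (-s)) * (ENNReal.ofReal κ⁻¹ * (K1 * a)) := by
    have h2 := conv_Lp_le kR hkc F hF p p' hpp
    rw [hdiff, eLpNorm_const_smul, hcn]
    calc _ ≤ ENNReal.ofReal κ⁻¹ * ENNReal.ofReal (R ^ (-s)) * (K1 * a) := by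
          refine mul_le_mul_right (h2.trans ?_) _
          rw [hn1]
          exact mul_le_mul_right hFa _
      _ = _ := by ring
  have hfin := interp_Lq _ _ _ p q hp0 hpq
    (ENNReal.mul_ne_top hκ' (ENNReal.mul_ne_top hK2t ha)) hsup hLp
  refine hfin.trans (le_of_eq ?_)
  rw [ENNReal.mul_rpow_of_nonneg _ _ (by positivity : 0 ≤ p / q),
    ENNReal.ofReal_rpow_of_pos (by positivity), ← Real.rpow_mul hR.le]
  have : -s * (p / q) = -(s * p / q) := by ring
  rw [this]
  ring

lemma high_scale (s R : ℝ) (hR : 0 < R) (w : E) :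
    (𝓕⁻ (highPsi s R hR : 𝓢(E, E →L[ℝ] ℂ))) w =
      (R ^ Module.finrank ℝ E) • (𝓕⁻ (highPsi s 1 one_pos : 𝓢(E, E →L[ℝ] ℂ))) (R • w) := by
  refine fourierInv_scale _ _ R hR (fun ξ => ?_) w
  change highFun s (R⁻¹ • ξ) = highFun s ((1 : ℝ)⁻¹ • (R⁻¹ • ξ))
  rw [inv_one, one_smul]

lemma high_bound [Nontrivial E] (s p q : ℝ) (hs0 : 0 < s) (hs1 : s < 1) (hp : 1 < p)
    (hsp : s * p = Module.finrank ℝ E) (hpq : p ≤ q) (a : ℝ≥0∞) (ha : a ≠ ⊤) :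
    ∃ C : ℝ≥0∞, C ≠ ⊤ ∧ ∀ (R : ℝ) (_ : 0 < R) (u : E → ℝ) (hu : ContDiff ℝ ∞ u)
      (hc : HasCompactSupport u),
      eLpNorm (fgrad ((Module.finrank ℝ E : ℝ) + s + 1) u) (ENNReal.ofReal p) volume ≤ a →
      eLpNorm (fun x => lpS (2 * R) (toS u hu hc) x - lpS R (toS u hu hc) x)
        (ENNReal.ofReal q) volume ≤ C * ENNReal.ofReal (R ^ (-(s * p / q))) := by
  obtain ⟨κ, hκ, hid⟩ := exists_high_identity (E := E) s hs0 hs1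
  obtain ⟨p', hpp⟩ : ∃ p', p.HolderConjugate p' := ⟨_, Real.HolderConjugate.conjExponent hp⟩
  have hp0 := hpp.pos
  have hq : 0 < q := hp0.trans_le hpq
  have hpq1 : p / q ≤ 1 := (div_le_one hq).2 hpq
  have hκ' : ENNReal.ofReal κ⁻¹ ≠ ⊤ := by simp
  have hsc := high_scale (E := E) s
  obtain ⟨k, hk⟩ : ∃ k : 𝓢(E, E →L[ℝ] ℂ), 𝓕⁻ (highPsi s 1 one_pos : 𝓢(E, E →L[ℝ] ℂ)) = k :=
    ⟨_, rfl⟩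
  rw [hk] at hsc
  obtain ⟨K1, hK1⟩ : ∃ K1, eLpNorm k (ENNReal.ofReal 1) volume = K1 := ⟨_, rfl⟩
  obtain ⟨K2, hK2⟩ : ∃ K2, eLpNorm k (ENNReal.ofReal p') volume = K2 := ⟨_, rfl⟩
  have hK1t : K1 ≠ ⊤ := by
    rw [← hK1]
    exact schwartz_ne_top k _
  have hK2t : K2 ≠ ⊤ := by
    rw [← hK2]
    exact schwartz_ne_top k _
  refine ⟨(ENNReal.ofReal κ⁻¹ * (K2 * a)) ^ (1 - p / q) * (ENNReal.ofReal κ⁻¹ * (K1 * a)) ^ (p / q),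
    ?_, fun R hR u hu hc hua => ?_⟩
  · refine ENNReal.mul_ne_top (ENNReal.rpow_ne_top_of_nonneg (by linarith) ?_)
      (ENNReal.rpow_ne_top_of_nonneg (by positivity) ?_)
    · exact ENNReal.mul_ne_top hκ' (ENNReal.mul_ne_top hK2t ha)
    · exact ENNReal.mul_ne_top hκ' (ENNReal.mul_ne_top hK1t ha)
  have hu1 : ContDiff ℝ 1 u := hu.of_le (by simp)
  have hF : AEStronglyMeasurable (fgrad ((Module.finrank ℝ E : ℝ) + s + 1) u) volume :=
    (fgrad_integrable s hs0 hs1 u hu1 hc).1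
  have h1 := hsc R hR
  have h2 := hid R hR u hu hc
  obtain ⟨kR, hkR⟩ : ∃ kR : 𝓢(E, E →L[ℝ] ℂ), 𝓕⁻ (highPsi s R hR : 𝓢(E, E →L[ℝ] ℂ)) = kR :=
    ⟨_, rfl⟩
  rw [hkR] at h1 h2
  exact high_bound_aux s p p' q hpp hsp hpq a ha κ hκ k kR k.continuous kR.continuous R hR
    (funext h1) K1 K2 hK1 hK2 hK2t _ hF hua _ h2

lemma tail_bound [Nontrivial E] (s p q : ℝ) (hs0 : 0 < s) (hs1 : s < 1) (hp : 1 < p)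
    (hsp : s * p = Module.finrank ℝ E) (hpq : p ≤ q) (a : ℝ≥0∞) (ha : a ≠ ⊤)
    (ε : ℝ≥0∞) (hε : 0 < ε) :
    ∃ J : ℕ, ∀ (u : E → ℝ) (hu : ContDiff ℝ ∞ u) (hc : HasCompactSupport u),
      eLpNorm (fgrad ((Module.finrank ℝ E : ℝ) + s + 1) u) (ENNReal.ofReal p) volume ≤ a →
      eLpNorm (fun x => (u x : ℂ) - lpS (2 ^ J) (toS u hu hc) x)
        (ENNReal.ofReal q) volume ≤ ε := by
  obtain ⟨C, hC, hb⟩ := high_bound (E := E) s p q hs0 hs1 hp hsp hpq a ha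
  have hq : 1 ≤ q := hp.le.trans hpq
  set δ := s * p / q with hδ
  have hδ0 : 0 < δ := by positivity
  set ρ : ℝ≥0∞ := ENNReal.ofReal (2 ^ (-δ)) with hρ
  have hρ1 : ρ < 1 := by
    rw [hρ, ENNReal.ofReal_lt_one]
    exact Real.rpow_lt_one_of_one_lt_of_neg one_lt_two (by linarith)
  have hpow : ∀ j : ℕ, ENNReal.ofReal (((2 : ℝ) ^ j) ^ (-δ)) = ρ ^ j := by
    intro j
    rw [hρ, ← ENNReal.ofReal_pow (by positivity)]
    congr 1
    rw [← Real.rpow_natCast, ← Real.rpow_natCast, ← Real.rpow_mul (by norm_num),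
      ← Real.rpow_mul (by norm_num), mul_comm]
  have htend : Tendsto (fun J : ℕ => C * (1 - ρ)⁻¹ * ρ ^ J) atTop (nhds 0) := by
    have h0 := ENNReal.tendsto_pow_atTop_nhds_zero_of_lt_one hρ1
    have hne : C * (1 - ρ)⁻¹ ≠ ⊤ := by
      refine ENNReal.mul_ne_top hC ?_
      rw [ENNReal.inv_ne_top]
      exact (tsub_pos_of_lt hρ1).ne'
    simpa using ENNReal.Tendsto.const_mul h0 (Or.inr hne)
  obtain ⟨J, hJ⟩ := (htend.eventually_le_const hε).exists
  refine ⟨J, fun u hu hc hua => ?_⟩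
  have hsum : ∀ m : ℕ, eLpNorm (fun x => lpS (2 ^ (J + m)) (toS u hu hc) x -
      lpS (2 ^ J) (toS u hu hc) x) (ENNReal.ofReal q) volume ≤ ∑ i ∈ Finset.range m, C * ρ ^ (J + i) := by
    intro m
    induction m with
    | zero => simp
    | succ m ih =>
      rw [Finset.sum_range_succ]
      have hdec : (fun x => lpS (2 ^ (J + (m + 1))) (toS u hu hc) x -
          lpS (2 ^ J) (toS u hu hc) x) = (fun x => lpS (2 ^ (J + m)) (toS u hu hc) x -
          lpS (2 ^ J) (toS u hu hc) x) + (fun x => lpS (2 * 2 ^ (J + m)) (toS u hu hc) x -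
          lpS (2 ^ (J + m)) (toS u hu hc) x) := by
        ext x
        simp only [Pi.add_apply]
        rw [← add_assoc, pow_succ', sub_add_sub_cancel']
      have hcS := fun R => lpS_continuous R (toS u hu hc)
      rw [hdec]
      refine (eLpNorm_add_le ?_ ?_ (by simpa using hq)).trans (add_le_add ih ?_)
      · exact ((hcS _).sub (hcS _)).aestronglyMeasurable
      · exact ((hcS _).sub (hcS _)).aestronglyMeasurable
      · have := hb (2 ^ (J + m)) (by positivity) u hu hc hua
        rwa [hpow] at this
  have hle : ∀ m : ℕ, eLpNorm (fun x => lpS (2 ^ (J + m)) (toS u hu hc) x -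
      lpS (2 ^ J) (toS u hu hc) x) (ENNReal.ofReal q) volume ≤ ε := by
    intro m
    refine (hsum m).trans (le_trans ?_ hJ)
    calc _ ≤ ∑' i : ℕ, C * ρ ^ (J + i) := ENNReal.sum_le_tsum _
      _ = _ := by
        simp_rw [pow_add, ← mul_assoc]
        rw [ENNReal.tsum_mul_left, ENNReal.tsum_geometric]
        ring
  refine (Lp.eLpNorm_lim_le_liminf_eLpNorm (f := fun m x => lpS (2 ^ (J + m)) (toS u hu hc) x -
      lpS (2 ^ J) (toS u hu hc) x) (fun m => ?_) _ (Eventually.of_forall fun x => ?_)).trans ?_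
  · exact ((lpS_continuous _ _).sub (lpS_continuous _ _)).aestronglyMeasurable
  · refine Tendsto.sub_const ?_ _
    have := (lpS_tendsto (toS u hu hc) x).comp (tendsto_add_atTop_nat J)
    simp only [Function.comp_def, add_comm _ J] at this
    exact this
  · refine (liminf_le_liminf (Eventually.of_forall hle)).trans ?_
    simp
end D
end Part3

section Part4
open MeasureTheory Filter Set
open scoped RealInnerProductSpace FourierTransform SchwartzMap ENNReal ContDiff

section EE
set_option linter.unusedSectionVars false
variable {E : Type*} [NormedAddCommGroup E] [InnerProductSpace ℝ E] [FiniteDimensional ℝ E]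
  [MeasurableSpace E] [BorelSpace E]

lemma one_add_norm_eLpNorm_ne_top (p' : ℝ) (hp' : 1 ≤ p') :
    eLpNorm (fun w : E => (1 + ‖w‖) ^ (-((Module.finrank ℝ E : ℝ) + 1))) (ENNReal.ofReal p') volume
      ≠ ⊤ := by
  have hm : AEStronglyMeasurable (fun w : E => (1 + ‖w‖) ^ (-((Module.finrank ℝ E : ℝ) + 1)))
      volume := by
    refine Continuous.aestronglyMeasurable ?_
    refine Continuous.rpow_const (by fun_prop) (fun x => Or.inl ?_)
    positivity
  have h0 : 0 < p' := by linarith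
  refine (((integrable_norm_rpow_iff hm (by simpa using h0) ENNReal.ofReal_ne_top).1 ?_).2).ne
  rw [ENNReal.toReal_ofReal h0.le]
  have h1 : (Module.finrank ℝ E : ℝ) < ((Module.finrank ℝ E : ℝ) + 1) * p' := by
    have : (0 : ℝ) ≤ Module.finrank ℝ E := by positivity
    nlinarith
  refine (integrable_one_add_norm (μ := volume) h1).congr (Eventually.of_forall fun w => ?_)
  have hw : 0 ≤ 1 + ‖w‖ := by positivity
  simp only
  rw [Real.norm_of_nonneg (by positivity), ← Real.rpow_mul hw]
  congr 1
  ring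

lemma schwartz_diff_bound {F : Type*} [NormedAddCommGroup F] [NormedSpace ℝ F] (k : 𝓢(E, F))
    (ρ : ℝ) (hρ : 0 ≤ ρ) :
    ∃ C : ℝ, 0 ≤ C ∧ ∀ x ∈ Metric.closedBall (0 : E) ρ, ∀ x' ∈ Metric.closedBall (0 : E) ρ, ∀ w : E,
      ‖k (x + w) - k (x' + w)‖ ≤ C * ‖x - x'‖ * (1 + ‖w‖) ^ (-((Module.finrank ℝ E : ℝ) + 1)) := by
  obtain ⟨C0, hC0⟩ : ∃ C0 : ℝ, ∀ z : E, (1 + ‖z‖) ^ (Module.finrank ℝ E + 1) * ‖fderiv ℝ k z‖ ≤ C0 := by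
    refine ⟨2 ^ (Module.finrank ℝ E + 1) * ((Finset.Iic (Module.finrank ℝ E + 1, 1)).sup
      fun m => SchwartzMap.seminorm ℝ m.1 m.2) k, fun z => ?_⟩
    rw [← norm_iteratedFDeriv_one]
    exact SchwartzMap.one_add_le_sup_seminorm_apply (𝕜 := ℝ) (m := (Module.finrank ℝ E + 1, 1))
      le_rfl le_rfl k z
  have hC0' : 0 ≤ C0 := le_trans (by positivity) (hC0 0)
  refine ⟨C0 * (1 + ρ) ^ (Module.finrank ℝ E + 1), by positivity, fun x hx x' hx' w => ?_⟩
  have hw : 0 < 1 + ‖w‖ := by positivity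
  have hpow : (1 + ‖w‖) ^ (-((Module.finrank ℝ E : ℝ) + 1)) =
      ((1 + ‖w‖) ^ (Module.finrank ℝ E + 1))⁻¹ := by
    rw [Real.rpow_neg hw.le, ← Real.rpow_natCast]
    push_cast
    rfl
  have hkd : Differentiable ℝ k := k.differentiable
  have hmain := Convex.norm_image_sub_le_of_norm_fderiv_le (𝕜 := ℝ) (f := fun z => k (z + w))
    (C := C0 * (1 + ρ) ^ (Module.finrank ℝ E + 1) * ((1 + ‖w‖) ^ (Module.finrank ℝ E + 1))⁻¹)
    (s := Metric.closedBall (0 : E) ρ) (x := x') (y := x)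
    (fun z _ => (hkd.comp (by fun_prop : Differentiable ℝ (fun z : E => z + w))).differentiableAt)
    (fun z hz => ?_) (convex_closedBall _ _) hx' hx
  · rw [hpow]
    calc _ ≤ _ := hmain
      _ = _ := by ring
  · rw [fderiv_comp_add_right]
    rw [← div_eq_mul_inv, le_div_iff₀ (by positivity)]
    have hz' : ‖z‖ ≤ ρ := by simpa using hz
    have h1 : 1 + ‖w‖ ≤ (1 + ‖z + w‖) * (1 + ρ) := by
      have : ‖w‖ ≤ ‖z + w‖ + ‖z‖ := by
        have := norm_sub_le (z + w) z
        simpa using this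
      nlinarith [norm_nonneg (z + w), norm_nonneg z]
    calc ‖fderiv ℝ k (z + w)‖ * (1 + ‖w‖) ^ (Module.finrank ℝ E + 1)
        ≤ ‖fderiv ℝ k (z + w)‖ * ((1 + ‖z + w‖) * (1 + ρ)) ^ (Module.finrank ℝ E + 1) := by gcongr
      _ = ((1 + ‖z + w‖) ^ (Module.finrank ℝ E + 1) * ‖fderiv ℝ k (z + w)‖) *
          (1 + ρ) ^ (Module.finrank ℝ E + 1) := by rw [mul_pow]; ring
      _ ≤ _ := by gcongr; exact hC0 _

lemma low_lip (k : 𝓢(E, ℝ →L[ℝ] ℂ)) (ρ : ℝ) (hρ : 0 ≤ ρ) (p p' : ℝ) (hpp : p.HolderConjugate p') :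
    ∃ C : ℝ≥0∞, C ≠ ⊤ ∧ ∀ (u : E → ℝ) (_ : Integrable u volume),
      ∀ x ∈ Metric.closedBall (0 : E) ρ, ∀ x' ∈ Metric.closedBall (0 : E) ρ,
      ‖(∫ y, k (x - y) (u y)) - ∫ y, k (x' - y) (u y)‖ₑ ≤
        C * ‖x - x'‖ₑ * eLpNorm u (ENNReal.ofReal p) volume := by
  obtain ⟨C, hC, hb⟩ := schwartz_diff_bound k ρ hρ
  have hp' : 1 ≤ p' := hpp.symm.lt.le
  refine ⟨ENNReal.ofReal C * eLpNorm (fun w : E => (1 + ‖w‖) ^ (-((Module.finrank ℝ E : ℝ) + 1)))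
    (ENNReal.ofReal p') volume,
    ENNReal.mul_ne_top ENNReal.ofReal_ne_top (one_add_norm_eLpNorm_ne_top p' hp'),
    fun u hu x hx x' hx' => ?_⟩
  obtain ⟨M, hM⟩ : ∃ M : ℝ, ∀ z, ‖k z‖ ≤ M := by
    obtain ⟨M, _, hM⟩ := k.decay 0 0
    exact ⟨M, fun z => by simpa using hM z⟩
  have hint : ∀ z : E, Integrable (fun y => k (z - y) (u y)) volume := by
    intro z
    refine (hu.norm.const_mul M).mono' ?_ (Eventually.of_forall fun y => ?_)
    · have hc : Continuous (fun y => k (z - y)) := k.continuous.comp (by fun_prop)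
      exact (ContinuousLinearMap.id ℝ (ℝ →L[ℝ] ℂ)).aestronglyMeasurable_comp₂
        hc.aestronglyMeasurable hu.1
    · exact ((k (z - y)).le_opNorm _).trans (by gcongr; exact hM _)
  rw [← integral_sub (hint x) (hint x')]
  have hkc : Continuous (fun w => k (x + w) - k (x' + w)) :=
    (k.continuous.comp (by fun_prop)).sub (k.continuous.comp (by fun_prop))
  have h1 := conv_sup_le (fun w => k (x + w) - k (x' + w)) hkc u hu.1 p p' hpp 0
  have h2 : ∫ y, (k (x - y) (u y) - k (x' - y) (u y)) =
      ∫ y, (k (x + (0 - y)) - k (x' + (0 - y))) (u y) := by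
    congr 1
    ext y
    simp [sub_eq_add_neg]
  rw [h2]
  refine h1.trans ?_
  gcongr
  have h3 : eLpNorm (fun w => k (x + w) - k (x' + w)) (ENNReal.ofReal p') volume ≤
      eLpNorm ((C * ‖x - x'‖) • (fun w : E => (1 + ‖w‖) ^ (-((Module.finrank ℝ E : ℝ) + 1))))
        (ENNReal.ofReal p') volume :=
    eLpNorm_mono_real (fun w => hb x hx x' hx' w)
  refine h3.trans ?_
  rw [eLpNorm_const_smul]
  rw [Real.enorm_of_nonneg (by positivity), ENNReal.ofReal_mul hC, ofReal_norm]
  exact le_of_eq (by ring)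

lemma finite_net (h : ℕ → E → ℂ) (ρ M L : ℝ)
    (hM : ∀ k, ∀ x ∈ Metric.closedBall (0 : E) ρ, ‖h k x‖ ≤ M)
    (hL : ∀ k, ∀ x ∈ Metric.closedBall (0 : E) ρ, ∀ x' ∈ Metric.closedBall (0 : E) ρ,
      ‖h k x - h k x'‖ ≤ L * ‖x - x'‖) (ε : ℝ) (hε : 0 < ε) :
    ∃ t : Set ℕ, t.Finite ∧ ∀ k, ∃ i ∈ t, ∀ x ∈ Metric.closedBall (0 : E) ρ, ‖h k x - h i x‖ ≤ ε := by
  have : CompactSpace (Metric.closedBall (0 : E) ρ) :=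
    isCompact_iff_compactSpace.1 (isCompact_closedBall _ _)
  have hL' : ∀ k, LipschitzWith (Real.toNNReal L)
      (fun x : Metric.closedBall (0 : E) ρ => h k x) := fun k =>
    LipschitzWith.of_dist_le_mul fun x y => by
      rw [dist_eq_norm]
      refine (hL k x x.2 y y.2).trans ?_
      rw [← dist_eq_norm, Subtype.dist_eq]
      gcongr
      exact Real.le_coe_toNNReal L
  set H : ℕ → BoundedContinuousFunction (Metric.closedBall (0 : E) ρ) ℂ := fun k =>
    BoundedContinuousFunction.mkOfCompact ⟨_, (hL' k).continuous⟩ with hH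
  have hcpt : IsCompact (closure (range H)) := by
    refine BoundedContinuousFunction.arzela_ascoli (Metric.closedBall (0 : ℂ) M)
      (isCompact_closedBall _ _) (range H) ?_ ?_
    · rintro _ x ⟨k, rfl⟩
      simpa [hH] using hM k x x.2
    · refine Metric.equicontinuous_of_continuity_modulus (fun d => (Real.toNNReal L : ℝ) * d) ?_ _ ?_
      · have : Tendsto (fun d : ℝ => (Real.toNNReal L : ℝ) * d) (nhds 0)
            (nhds ((Real.toNNReal L : ℝ) * 0)) := tendsto_id.const_mul _
        simpa using this
      · rintro x y ⟨_, k, rfl⟩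
        exact (hL' k).dist_le_mul x y
  have htb : TotallyBounded (range H) := hcpt.totallyBounded.subset subset_closure
  obtain ⟨t, hts, htf, htc⟩ := Metric.finite_approx_of_totallyBounded htb ε hε
  obtain ⟨t', ht'f, rfl⟩ : ∃ t' : Set ℕ, t'.Finite ∧ H '' t' = t := by
    have hts' : ∀ y ∈ t, ∃ i, H i = y := fun y hy => hts hy
    choose! g hg using hts'
    refine ⟨g '' t, htf.image g, ?_⟩
    rw [image_image]
    exact (image_congr hg).trans (image_id' t)
  refine ⟨t', ht'f, fun k => ?_⟩
  have := htc (mem_range_self k)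
  simp only [mem_iUnion, Metric.mem_ball, exists_prop] at this
  obtain ⟨_, ⟨i, hi, rfl⟩, hd⟩ := this
  refine ⟨i, hi, fun x hx => ?_⟩
  have h1 := (BoundedContinuousFunction.dist_coe_le_dist (f := H k) (g := H i) ⟨x, hx⟩).trans hd.le
  rw [dist_eq_norm] at h1
  exact h1
end EE
end Part4

section Part5
open MeasureTheory Filter Set
open scoped RealInnerProductSpace FourierTransform SchwartzMap ENNReal NNReal ContDiff

section FF
set_option linter.unusedSectionVars false
variable {E : Type*} [NormedAddCommGroup E] [InnerProductSpace ℝ E] [FiniteDimensional ℝ E]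
  [MeasurableSpace E] [BorelSpace E]

lemma range_net [Nontrivial E] (s p q : ℝ) (hs0 : 0 < s) (hs1 : s < 1) (hp : 1 < p)
    (hsp : s * p = Module.finrank ℝ E) (hpq : p ≤ q) (a : ℝ≥0∞) (ha : a ≠ ⊤)
    (u : ℕ → E → ℝ) (hu : ∀ k, ContDiff ℝ ∞ (u k)) (hc : ∀ k, HasCompactSupport (u k))
    (hua : ∀ k, eLpNorm (u k) (ENNReal.ofReal p) volume ≤ a)
    (hga : ∀ k, eLpNorm (fgrad ((Module.finrank ℝ E : ℝ) + s + 1) (u k))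
      (ENNReal.ofReal p) volume ≤ a)
    (Ω : Set E) (hΩm : MeasurableSet Ω) (ρ : ℝ) (hρ : 0 ≤ ρ) (hΩ : Ω ⊆ Metric.closedBall (0 : E) ρ)
    (ε : ℝ≥0∞) (hε : 0 < ε) :
    ∃ t : Set ℕ, t.Finite ∧ ∀ k, ∃ i ∈ t,
      eLpNorm (fun x => u k x - u i x) (ENNReal.ofReal q) (volume.restrict Ω) ≤ ε := by
  have hq : 1 ≤ q := hp.le.trans hpq
  have hε3 : 0 < ε / 3 := ENNReal.div_pos hε.ne' (by simp)
  obtain ⟨J, hJ⟩ := tail_bound (E := E) s p q hs0 hs1 hp hsp hpq a ha (ε / 3) hε3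
  obtain ⟨p', hpp⟩ : ∃ p', p.HolderConjugate p' := ⟨_, Real.HolderConjugate.conjExponent hp⟩
  have hR : (0 : ℝ) < 2 ^ J := by positivity
  have heq := fun k x => lpS_eq_low (2 ^ J) hR (u k) (hu k) (hc k) x
  obtain ⟨κ, hκ⟩ : ∃ κ : 𝓢(E, ℝ →L[ℝ] ℂ), 𝓕⁻ (lowPsi (2 ^ J) hR : 𝓢(E, ℝ →L[ℝ] ℂ)) = κ :=
    ⟨_, rfl⟩
  rw [hκ] at heq
  obtain ⟨h, hh⟩ : ∃ h : ℕ → E → ℂ, ∀ k, h k = lpS (2 ^ J) (toS (u k) (hu k) (hc k)) :=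
    ⟨_, fun k => rfl⟩
  have hint : ∀ k, Integrable (u k) volume := fun k =>
    (hu k).continuous.integrable_of_hasCompactSupport (hc k)
  have hhc : ∀ k, Continuous (h k) := fun k => by rw [hh]; exact lpS_continuous _ _
  obtain ⟨C, hC, hlip⟩ := low_lip κ ρ hρ p p' hpp
  have hbM : ∀ k x, ‖h k x‖ ≤ (eLpNorm κ (ENNReal.ofReal p') volume * a).toReal := by
    intro k x
    rw [← toReal_enorm]
    refine ENNReal.toReal_mono (ENNReal.mul_ne_top (schwartz_ne_top κ _) ha) ?_
    rw [hh, heq]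
    refine (conv_sup_le κ κ.continuous (u k) (hint k).1 p p' hpp x).trans ?_
    exact mul_le_mul_right (hua k) _
  have hbL : ∀ k, ∀ x ∈ Metric.closedBall (0 : E) ρ, ∀ x' ∈ Metric.closedBall (0 : E) ρ,
      ‖h k x - h k x'‖ ≤ (C * a).toReal * ‖x - x'‖ := by
    intro k x hx x' hx'
    rw [← toReal_enorm, ← toReal_enorm (x - x'), ← ENNReal.toReal_mul]
    refine ENNReal.toReal_mono (ENNReal.mul_ne_top (ENNReal.mul_ne_top hC ha) enorm_ne_top) ?_
    rw [hh, heq, heq]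
    refine (hlip (u k) (hint k) x hx x' hx').trans ?_
    refine (mul_le_mul_right (hua k) _).trans (le_of_eq (by ring))
  have hV : (volume.restrict Ω) univ ^ (ENNReal.ofReal q).toReal⁻¹ ≠ ⊤ := by
    refine ENNReal.rpow_ne_top_of_nonneg (by positivity) ?_
    rw [Measure.restrict_apply_univ]
    exact ((measure_mono hΩ).trans_lt measure_closedBall_lt_top).ne
  obtain ⟨δ, hδ, hδV⟩ := ENNReal.exists_nnreal_pos_mul_lt hV hε3.ne'
  obtain ⟨t, htf, ht⟩ := finite_net h ρ _ _ (fun k x _ => hbM k x) hbL (δ : ℝ) hδ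
  refine ⟨t, htf, fun k => ?_⟩
  obtain ⟨i, hi, hki⟩ := ht k
  refine ⟨i, hi, ?_⟩
  have hq1 : 1 ≤ ENNReal.ofReal q := by simpa using hq
  have e1 : eLpNorm (fun x => u k x - u i x) (ENNReal.ofReal q) (volume.restrict Ω) =
      eLpNorm (((fun x => (u k x : ℂ) - h k x) - (fun x => (u i x : ℂ) - h i x)) +
        (fun x => h k x - h i x)) (ENNReal.ofReal q) (volume.restrict Ω) := by
    refine eLpNorm_congr_norm_ae (Eventually.of_forall fun x => ?_)
    have : (((fun x => (u k x : ℂ) - h k x) - (fun x => (u i x : ℂ) - h i x)) +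
        (fun x => h k x - h i x)) x = ((u k x - u i x : ℝ) : ℂ) := by
      simp only [Pi.add_apply, Pi.sub_apply]
      push_cast
      ring
    rw [this, Complex.norm_real]
  have hm : ∀ k, AEStronglyMeasurable (fun x => (u k x : ℂ) - h k x) (volume.restrict Ω) := by
    intro k
    have h1 := (hu k).continuous
    have h2 := hhc k
    exact (Complex.continuous_ofReal.comp h1 |>.sub h2).aestronglyMeasurable
  have ht1 : ∀ k, eLpNorm (fun x => (u k x : ℂ) - h k x) (ENNReal.ofReal q) (volume.restrict Ω)
      ≤ ε / 3 := by
    intro k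
    refine (eLpNorm_mono_measure _ Measure.restrict_le_self).trans ?_
    rw [hh]
    exact hJ (u k) (hu k) (hc k) (hga k)
  have ht2 : eLpNorm (fun x => h k x - h i x) (ENNReal.ofReal q) (volume.restrict Ω) ≤ ε / 3 := by
    refine (eLpNorm_le_of_ae_bound (C := (δ : ℝ)) ?_).trans ?_
    · filter_upwards [ae_restrict_mem hΩm] with x hx using hki x (hΩ hx)
    · rw [mul_comm, ENNReal.ofReal_coe_nnreal]
      exact hδV.le
  rw [e1]
  calc _ ≤ (ε / 3 + ε / 3) + ε / 3 := by
        refine (eLpNorm_add_le ((hm k).sub (hm i))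
          ((hhc k).sub (hhc i)).aestronglyMeasurable hq1).trans (add_le_add ?_ ht2)
        exact (eLpNorm_sub_le (hm k) (hm i) hq1).trans (add_le_add (ht1 k) (ht1 i))
    _ = ε := ENNReal.add_thirds ε

lemma subseq_of_net {X : Type*} [MeasurableSpace X] (μ : Measure X) [IsFiniteMeasure μ]
    (q : ℝ≥0∞) (hq : 1 ≤ q) (u : ℕ → X → ℝ)
    (hu : ∀ k, MemLp (u k) q μ)
    (hnet : ∀ ε : ℝ≥0∞, 0 < ε → ∃ t : Set ℕ, t.Finite ∧ ∀ k, ∃ i ∈ t,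
      eLpNorm (fun x => u k x - u i x) q μ ≤ ε) :
    ∃ (φ : ℕ → ℕ) (f : X → ℝ), StrictMono φ ∧ AEStronglyMeasurable f μ ∧
      Tendsto (fun j => eLpNorm (fun x => u (φ j) x - f x) q μ) atTop (nhds 0) := by
  have : Fact (1 ≤ q) := ⟨hq⟩
  set v : ℕ → Lp ℝ q μ := fun k => (hu k).toLp (u k) with hv
  have htb : TotallyBounded (range v) := by
    rw [EMetric.totallyBounded_iff]
    intro ε hε
    obtain ⟨t, htf, ht⟩ := hnet (min 1 (ε / 2)) (lt_min one_pos (ENNReal.div_pos hε.ne' (by simp)))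
    refine ⟨v '' t, htf.image v, ?_⟩
    rintro _ ⟨k, rfl⟩
    obtain ⟨i, hi, hki⟩ := ht k
    simp only [mem_iUnion, exists_prop]
    refine ⟨v i, mem_image_of_mem v hi, ?_⟩
    rw [Metric.mem_eball, hv, Lp.edist_toLp_toLp]
    refine lt_of_le_of_lt hki ?_
    rcases eq_or_ne ε ⊤ with rfl | hεt
    · exact (min_le_left _ _).trans_lt (by simp)
    · exact (min_le_right _ _).trans_lt (ENNReal.half_lt_self hε.ne' hεt)
  have hcpt : IsCompact (closure (range v)) :=
    htb.closure.isCompact_of_isClosed isClosed_closure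
  obtain ⟨g, _, φ, hφ, hlim⟩ := hcpt.tendsto_subseq (x := v)
    (fun k => subset_closure (mem_range_self k))
  refine ⟨φ, g, hφ, (Lp.aestronglyMeasurable g), ?_⟩
  rw [tendsto_iff_edist_tendsto_0] at hlim
  refine hlim.congr fun j => ?_
  rw [Function.comp_apply, Lp.edist_def]
  refine eLpNorm_congr_ae ?_
  filter_upwards [(hu (φ j)).coeFn_toLp] with x hx
  simp only [Pi.sub_apply]
  rw [hv, hx]
end FF
end Part5

lemma rieszGrad_eq (n : ℕ) (s : ℝ) (u : EuclideanSpace ℝ (Fin n) → ℝ) :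
    rieszGrad n s u = cns n s • fgrad ((n : ℝ) + s + 1) u := by
  ext1 x
  rw [Pi.smul_apply, rieszGrad, fgrad]
  congr 1
  rw [← integral_sub_left_eq_self _ volume x]
  congr 1
  ext1 z
  simp only [gradKer]
  rw [sub_sub_cancel]

lemma cns_pos (n : ℕ) (hn : 1 ≤ n) (s : ℝ) (hs0 : 0 < s) (hs1 : s < 1) : 0 < cns n s := by
  have h1 : (1 : ℝ) ≤ n := by exact_mod_cast hn
  have h2 : 0 < (n : ℝ) + s - 1 := by linarith
  have h3 : 0 < Real.Gamma (((n : ℝ) + s - 1) / 2) := Real.Gamma_pos_of_pos (by linarith)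
  have h4 : 0 < Real.Gamma ((1 - s) / 2) := Real.Gamma_pos_of_pos (by linarith)
  have := Real.pi_pos
  unfold cns
  positivity

/-- Compact embedding `H^{s,p}(ℝⁿ) ↪↪ L^q(Ω)`, critical case `sp = n`, `1 ≤ q < ∞`. -/
theorem bessel_compact_embedding_critical
    (n : ℕ) (hn : 1 ≤ n) (s p : ℝ) (hs0 : 0 < s) (hs1 : s < 1)
    (hp : 1 ≤ p) (hsp : s * p = n)
    (Ω : Set (EuclideanSpace ℝ (Fin n))) (hΩopen : IsOpen Ω)
    (hΩbdd : Bornology.IsBounded Ω)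
    (q : ℝ) (hq : 1 ≤ q)
    (u : ℕ → EuclideanSpace ℝ (Fin n) → ℝ)
    (husmooth : ∀ k, ContDiff ℝ (⊤ : ℕ∞) (u k))
    (husupp : ∀ k, HasCompactSupport (u k))
    (hbdd : (⨆ k, eLpNorm (u k) (ENNReal.ofReal p) volume
        + eLpNorm (rieszGrad n s (u k)) (ENNReal.ofReal p) volume) < ⊤) :
    ∃ (φ : ℕ → ℕ) (f : EuclideanSpace ℝ (Fin n) → ℝ), StrictMono φ ∧
      Tendsto (fun j => eLpNorm (fun x => u (φ j) x - f x) (ENNReal.ofReal q)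
        (volume.restrict Ω)) atTop (nhds 0) := by
  have hn1 : (1 : ℝ) ≤ n := by exact_mod_cast hn
  have hp1 : 1 < p := by nlinarith
  have hfr : Module.finrank ℝ (EuclideanSpace ℝ (Fin n)) = n := finrank_euclideanSpace_fin
  have : Nontrivial (EuclideanSpace ℝ (Fin n)) :=
    Module.nontrivial_of_finrank_pos (R := ℝ) (by rw [hfr]; omega)
  have hcp := cns_pos n hn s hs0 hs1
  obtain ⟨A, hA⟩ : ∃ A, (⨆ k, eLpNorm (u k) (ENNReal.ofReal p) volume
        + eLpNorm (rieszGrad n s (u k)) (ENNReal.ofReal p) volume) = A := ⟨_, rfl⟩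
  rw [hA] at hbdd
  have hAk : ∀ k, eLpNorm (u k) (ENNReal.ofReal p) volume
        + eLpNorm (rieszGrad n s (u k)) (ENNReal.ofReal p) volume ≤ A := fun k => by
    rw [← hA]
    exact le_iSup (fun k => eLpNorm (u k) (ENNReal.ofReal p) volume
        + eLpNorm (rieszGrad n s (u k)) (ENNReal.ofReal p) volume) k
  have hua : ∀ k, eLpNorm (u k) (ENNReal.ofReal p) volume ≤ A + ENNReal.ofReal (cns n s)⁻¹ * A :=
    fun k => (le_self_add.trans (hAk k)).trans le_self_add
  have hga : ∀ k, eLpNorm (fgrad ((Module.finrank ℝ (EuclideanSpace ℝ (Fin n)) : ℝ) + s + 1) (u k))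
      (ENNReal.ofReal p) volume ≤ A + ENNReal.ofReal (cns n s)⁻¹ * A := by
    intro k
    have h1 : fgrad ((n : ℝ) + s + 1) (u k) = (cns n s)⁻¹ • rieszGrad n s (u k) := by
      rw [rieszGrad_eq, inv_smul_smul₀ hcp.ne']
    rw [hfr, h1, eLpNorm_const_smul, Real.enorm_of_nonneg (by positivity)]
    refine le_trans ?_ le_add_self
    exact mul_le_mul_right (le_add_self.trans (hAk k)) _
  have hA2 : A + ENNReal.ofReal (cns n s)⁻¹ * A ≠ ⊤ :=
    ENNReal.add_ne_top.2 ⟨hbdd.ne, ENNReal.mul_ne_top ENNReal.ofReal_ne_top hbdd.ne⟩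
  obtain ⟨ρ0, hρ0⟩ := hΩbdd.subset_closedBall 0
  have hΩ : Ω ⊆ Metric.closedBall 0 (max ρ0 0) :=
    hρ0.trans (Metric.closedBall_subset_closedBall (le_max_left _ _))
  have hfin : IsFiniteMeasure (volume.restrict Ω) := ⟨by
    rw [Measure.restrict_apply_univ]
    exact (measure_mono hΩ).trans_lt measure_closedBall_lt_top⟩
  have hnet := range_net s p (max p q) hs0 hs1 hp1 (by rw [hfr]; exact hsp) (le_max_left _ _)
    _ hA2 u husmooth husupp hua hga Ω hΩopen.measurableSet (max ρ0 0) (le_max_right _ _) hΩ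
  have hq1 : 1 ≤ ENNReal.ofReal (max p q) := by
    rw [ENNReal.one_le_ofReal]
    exact le_max_of_le_left hp
  obtain ⟨φ, f, hφ, hfm, hlim⟩ := subseq_of_net (volume.restrict Ω) _ hq1 u
    (fun k => ((husmooth k).continuous.memLp_of_hasCompactSupport (husupp k)).restrict Ω) hnet
  refine ⟨φ, f, hφ, ?_⟩
  have hb : ∀ j, eLpNorm (fun x => u (φ j) x - f x) (ENNReal.ofReal q) (volume.restrict Ω) ≤
      eLpNorm (fun x => u (φ j) x - f x) (ENNReal.ofReal (max p q)) (volume.restrict Ω) *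
      (volume.restrict Ω) Set.univ ^ (1 / (ENNReal.ofReal q).toReal -
        1 / (ENNReal.ofReal (max p q)).toReal) := fun j =>
    eLpNorm_le_eLpNorm_mul_rpow_measure_univ (ENNReal.ofReal_le_ofReal (le_max_right _ _))
      ((husmooth (φ j)).continuous.aestronglyMeasurable.sub hfm)
  refine tendsto_of_tendsto_of_tendsto_of_le_of_le tendsto_const_nhds ?_ (fun _ => zero_le) hb
  have hne : (volume.restrict Ω) Set.univ ^ (1 / (ENNReal.ofReal q).toReal -
        1 / (ENNReal.ofReal (max p q)).toReal) ≠ ⊤ := by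
    refine ENNReal.rpow_ne_top_of_nonneg ?_ (measure_ne_top _ _)
    rw [ENNReal.toReal_ofReal (by linarith), ENNReal.toReal_ofReal (le_max_of_le_right (by linarith)),
      sub_nonneg]
    exact one_div_le_one_div_of_le (by linarith) (le_max_right _ _)
  simpa using ENNReal.Tendsto.mul_const hlim (Or.inr hne)

end
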